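/- For every smooth embedding f : S³ → S⁶, the complement S⁶ \ f(S³) (with its subspace topology) is homotopy equivalent to the 2-sphere S². -/

import Mathlib

/- STATEMENT 6: For every smooth embedding f : S³ → S⁶, the complement
   S⁶ \ f(S³) (with its subspace topology) is homotopy equivalent to S². -/

open scoped Manifold

noncomputable section

abbrev E (n : ℕ) : Type := EuclideanSpace ℝ (Fin n)
abbrev Sph (n : ℕ) : Set (E (n + 1)) := Metric.sphere 0 1

/-- A smooth embedding between spheres: a `C^∞` map which is a topological
embedding and whose differential is injective at every point. -/
def IsSmoothEmbedding {m n : ℕ} (f : Sph m → Sph n) : Prop :=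
  ContMDiff (𝓡 m) (𝓡 n) (⊤ : ℕ∞) f ∧ Topology.IsEmbedding f ∧
    ∀ x, Function.Injective (mfderiv (𝓡 m) (𝓡 n) f x)

open Set Metric Topology

/-- The smallest closed cell of the unit cubical grid of `κ → ℝ` that contains `x`. -/
def gridCell {κ : Type} (x : κ → ℝ) : Set (κ → ℝ) :=
  {y | ∀ i, (⌊x i⌋ : ℝ) ≤ y i ∧ y i ≤ (⌈x i⌉ : ℝ)}

/-- The dimension of `gridCell x`. -/
noncomputable def gridDim {κ : Type} (x : κ → ℝ) : ℕ := Nat.card {i // ⌊x i⌋ ≠ ⌈x i⌉}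

/-- Twice the centre of `gridCell x`. -/
noncomputable def gridCode {κ : Type} (x : κ → ℝ) : κ → ℤ := fun i => ⌊x i⌋ + ⌈x i⌉

/-- The point with half-integer coordinates `c / 2`. -/
noncomputable def gridCentre {κ : Type} (c : κ → ℤ) : κ → ℝ := fun i => (c i : ℝ) / 2

lemma ceil_eq_floor_or (r : ℝ) :
    (⌈r⌉ = ⌊r⌋ ∧ r = ⌊r⌋) ∨ (⌈r⌉ = ⌊r⌋ + 1 ∧ (⌊r⌋ : ℝ) < r ∧ r < ⌊r⌋ + 1) := by
  rcases eq_or_lt_of_le (Int.floor_le r) with h | h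
  · left
    refine ⟨?_, h.symm⟩
    rw [Int.ceil_eq_iff]; constructor <;> linarith
  · right
    refine ⟨?_, h, Int.lt_floor_add_one r⟩
    rw [Int.ceil_eq_iff]; push_cast; constructor <;> linarith [Int.lt_floor_add_one r]

section Grid

variable {κ : Type}

lemma mem_gridCell_self (x : κ → ℝ) : x ∈ gridCell x :=
  fun _ => ⟨Int.floor_le _, Int.le_ceil _⟩

lemma gridCell_subset {x y : κ → ℝ} (h : y ∈ gridCell x) : gridCell y ⊆ gridCell x := by
  intro z hz i
  have h1 : (⌊x i⌋ : ℤ) ≤ ⌊y i⌋ := Int.le_floor.2 (h i).1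
  have h2 : (⌈y i⌉ : ℤ) ≤ ⌈x i⌉ := Int.ceil_le.2 (h i).2
  have h1' : (⌊x i⌋ : ℝ) ≤ ⌊y i⌋ := by exact_mod_cast h1
  have h2' : (⌈y i⌉ : ℝ) ≤ ⌈x i⌉ := by exact_mod_cast h2
  exact ⟨h1'.trans (hz i).1, (hz i).2.trans h2'⟩

lemma isClosed_gridCell (x : κ → ℝ) : IsClosed (gridCell x) := by
  have : gridCell x = ⋂ i, {y : κ → ℝ | (⌊x i⌋ : ℝ) ≤ y i ∧ y i ≤ (⌈x i⌉ : ℝ)} := by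
    ext y; simp [gridCell]
  rw [this]
  refine isClosed_iInter fun i => ?_
  exact (isClosed_le continuous_const (continuous_apply i)).inter
    (isClosed_le (continuous_apply i) continuous_const)

lemma floor_ceil_gridCentre (x : κ → ℝ) (i : κ) :
    ⌊gridCentre (gridCode x) i⌋ = ⌊x i⌋ ∧ ⌈gridCentre (gridCode x) i⌉ = ⌈x i⌉ := by
  unfold gridCentre gridCode
  rw [Int.floor_eq_iff, Int.ceil_eq_iff]
  rcases ceil_eq_floor_or (x i) with ⟨h, -⟩ | ⟨h, -⟩ <;> rw [h] <;> push_cast <;>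
    refine ⟨⟨?_, ?_⟩, ?_, ?_⟩ <;> linarith

lemma gridCell_gridCentre (x : κ → ℝ) : gridCell (gridCentre (gridCode x)) = gridCell x := by
  ext y; simp only [gridCell, mem_ofPred_eq, floor_ceil_gridCentre]

lemma gridDim_gridCentre (x : κ → ℝ) : gridDim (gridCentre (gridCode x)) = gridDim x := by
  simp only [gridDim, floor_ceil_gridCentre]

variable [Fintype κ]

lemma gridDim_le {x y : κ → ℝ} (h : y ∈ gridCell x) : gridDim y ≤ gridDim x := by
  refine Nat.card_mono (s := {i | ⌊y i⌋ ≠ ⌈y i⌉}) (t := {i | ⌊x i⌋ ≠ ⌈x i⌉}) (Set.toFinite _) ?_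
  intro i hi hx
  have := h i
  have h1 : (⌊x i⌋ : ℤ) ≤ ⌊y i⌋ := Int.le_floor.2 this.1
  have h2 : (⌈y i⌉ : ℤ) ≤ ⌈x i⌉ := Int.ceil_le.2 this.2
  have h3 := Int.floor_le_ceil (y i)
  apply hi; omega

/-- A point of a cell whose own cell has the same dimension lies in the open cell. -/
lemma floor_ceil_eq_of_gridDim_le {x y : κ → ℝ} (h : y ∈ gridCell x) (hd : gridDim x ≤ gridDim y) (i : κ) :
    ⌊y i⌋ = ⌊x i⌋ ∧ ⌈y i⌉ = ⌈x i⌉ := by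
  have hsub : {i | ⌊y i⌋ ≠ ⌈y i⌉} ⊆ {i | ⌊x i⌋ ≠ ⌈x i⌉} := by
    intro i hi hx
    have := h i
    have h1 : (⌊x i⌋ : ℤ) ≤ ⌊y i⌋ := Int.le_floor.2 this.1
    have h2 : (⌈y i⌉ : ℤ) ≤ ⌈x i⌉ := Int.ceil_le.2 this.2
    have h3 := Int.floor_le_ceil (y i)
    apply hi; omega
  have heq : {i | ⌊y i⌋ ≠ ⌈y i⌉} = {i | ⌊x i⌋ ≠ ⌈x i⌉} :=
    Set.eq_of_subset_of_ncard_le hsub hd (Set.toFinite _)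
  have h1 : (⌊x i⌋ : ℤ) ≤ ⌊y i⌋ := Int.le_floor.2 (h i).1
  have h2 : (⌈y i⌉ : ℤ) ≤ ⌈x i⌉ := Int.ceil_le.2 (h i).2
  have h3 := Int.floor_le_ceil (y i)
  have h4 : ⌊y i⌋ ≠ ⌈y i⌉ ↔ ⌊x i⌋ ≠ ⌈x i⌉ := by
    change i ∈ {i | ⌊y i⌋ ≠ ⌈y i⌉} ↔ i ∈ {i | ⌊x i⌋ ≠ ⌈x i⌉}
    rw [heq]
  rcases ceil_eq_floor_or (x i) with ⟨h, -⟩ | ⟨h, -⟩ <;>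
    rcases ceil_eq_floor_or (y i) with ⟨h', -⟩ | ⟨h', -⟩ <;> omega

lemma gridCell_eq_of_gridDim_le {x y : κ → ℝ} (h : y ∈ gridCell x) (hd : gridDim x ≤ gridDim y) :
    gridCell y = gridCell x := by
  ext z; simp only [gridCell, mem_ofPred_eq, floor_ceil_eq_of_gridDim_le h hd]

lemma gridDim_le_card (x : κ → ℝ) : gridDim x ≤ Fintype.card κ := by
  rw [← Nat.card_eq_fintype_card]
  exact Nat.card_le_card_of_injective _ Subtype.val_injective

/-- The union of the proper faces of `gridCell x`. -/
def gridBdry (x : κ → ℝ) : Set (κ → ℝ) := {y ∈ gridCell x | gridDim y < gridDim x}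

lemma locallyFinite_gridCell : LocallyFinite fun c : κ → ℤ => gridCell (gridCentre c) := by
  intro x
  refine ⟨ball x 1, ball_mem_nhds x one_pos, ?_⟩
  have hfin : (Set.pi univ fun i => Set.Icc (2 * ⌊x i⌋ - 4) (2 * ⌊x i⌋ + 6)).Finite :=
    Set.Finite.pi fun i => Set.finite_Icc _ _
  refine hfin.subset ?_
  rintro c ⟨y, hy, hyx⟩ i -
  have h1 := (hy i).1
  have h2 := (hy i).2
  have h3 : |y i - x i| < 1 := by
    have := (dist_pi_lt_iff one_pos).1 (mem_ball.1 hyx) i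
    rwa [Real.dist_eq] at this
  rw [abs_lt] at h3
  have h4 := Int.sub_one_lt_floor (gridCentre c i)
  have h5 := Int.ceil_lt_add_one (gridCentre c i)
  unfold gridCentre at h1 h2 h4 h5
  have h6 := Int.floor_le (x i)
  have h7 := Int.lt_floor_add_one (x i)
  constructor
  · have : ((2 * ⌊x i⌋ - 4 : ℤ) : ℝ) ≤ c i := by push_cast; linarith
    exact_mod_cast this
  · have : (c i : ℝ) ≤ ((2 * ⌊x i⌋ + 6 : ℤ) : ℝ) := by push_cast; linarith
    exact_mod_cast this

/-- Gluing along the cells of a union of cells. -/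
lemma continuousOn_of_gridCell {M : Type*} [TopologicalSpace M] {D : Set (κ → ℝ)}
    (hD : ∀ x ∈ D, gridCell x ⊆ D) {T : Set ℝ} (hT : IsClosed T) {φ : (κ → ℝ) × ℝ → M}
    (h : ∀ x ∈ D, ContinuousOn φ (gridCell x ×ˢ T)) : ContinuousOn φ (D ×ˢ T) := by
  have hcov : D ×ˢ T = ⋃ c : gridCode '' D, gridCell (gridCentre c.1) ×ˢ T := by
    ext ⟨y, t⟩
    simp only [mem_prod, mem_iUnion, Subtype.exists, mem_image, exists_prop]
    constructor
    · rintro ⟨hy, ht⟩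
      exact ⟨_, ⟨y, hy, rfl⟩, by rw [gridCell_gridCentre]; exact mem_gridCell_self y, ht⟩
    · rintro ⟨_, ⟨x, hx, rfl⟩, hy, ht⟩
      rw [gridCell_gridCentre] at hy
      exact ⟨hD x hx hy, ht⟩
  rw [hcov]
  refine LocallyFinite.continuousOn_iUnion ?_ ?_ ?_
  · have h1 : LocallyFinite fun c : gridCode '' D => gridCell (gridCentre c.1) :=
      locallyFinite_gridCell.comp_injective Subtype.val_injective
    exact (h1.preimage_continuous continuous_fst).subset fun c p hp => hp.1
  · rintro ⟨c, hc⟩; exact (isClosed_gridCell _).prod hT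
  · rintro ⟨c, x, hx, rfl⟩
    rw [gridCell_gridCentre]; exact h x hx

/-- Cell-by-cell construction of a family of paths over a union of grid cells. -/
theorem exists_extension_of_gridCell {M : Type*} [TopologicalSpace M] {C₀ C : Set (κ → ℝ)}
    (h₀C : C₀ ⊆ C) (hC₀ : ∀ x ∈ C₀, gridCell x ⊆ C₀) (hC : ∀ x ∈ C, gridCell x ⊆ C)
    (Q : (κ → ℝ) → (ℝ → M) → Prop) (φ₀ : (κ → ℝ) → ℝ → M)
    (hφ₀ : ContinuousOn (Function.uncurry φ₀) (C₀ ×ˢ Icc 0 1)) (hQ₀ : ∀ x ∈ C₀, Q x (φ₀ x))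
    (step : ∀ x ∈ C \ C₀, ∀ ψ : (κ → ℝ) → ℝ → M,
      ContinuousOn (Function.uncurry ψ) (gridBdry x ×ˢ Icc 0 1) → (∀ y ∈ gridBdry x, Q y (ψ y)) →
      ∃ ψ' : (κ → ℝ) → ℝ → M, ContinuousOn (Function.uncurry ψ') (gridCell x ×ˢ Icc 0 1) ∧
        (∀ y ∈ gridBdry x, ∀ s ∈ Icc (0 : ℝ) 1, ψ' y s = ψ y s) ∧
        ∀ y ∈ gridCell x, gridCell y = gridCell x → Q y (ψ' y)) :
    ∃ φ : (κ → ℝ) → ℝ → M, ContinuousOn (Function.uncurry φ) (C ×ˢ Icc 0 1) ∧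
      (∀ x ∈ C₀, φ x = φ₀ x) ∧ ∀ x ∈ C, Q x (φ x) := by
  classical
  suffices H : ∀ k : ℕ, ∃ φ : (κ → ℝ) → ℝ → M,
      ContinuousOn (Function.uncurry φ) ((C₀ ∪ {x ∈ C | gridDim x < k}) ×ˢ Icc 0 1) ∧
      (∀ x ∈ C₀, φ x = φ₀ x) ∧ ∀ x ∈ C₀ ∪ {x ∈ C | gridDim x < k}, Q x (φ x) by
    have h : C = C₀ ∪ {x ∈ C | gridDim x < Fintype.card κ + 1} := by
      ext x
      refine ⟨fun hx => Or.inr ⟨hx, Nat.lt_succ_of_le (gridDim_le_card x)⟩, ?_⟩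
      rintro (hx | hx)
      exacts [h₀C hx, hx.1]
    rw [h]; exact H _
  intro k
  induction k with
  | zero => exact ⟨φ₀, by simpa using hφ₀, fun _ _ => rfl, by simpa using hQ₀⟩
  | succ k ih =>
    obtain ⟨φ, hφc, hφ0, hφQ⟩ := ih
    set D := C₀ ∪ {x ∈ C | gridDim x < k} with hDdef
    have hD : ∀ x ∈ D, gridCell x ⊆ D := by
      rintro x (hx | hx)
      · exact (hC₀ x hx).trans subset_union_left
      · exact fun y hy => Or.inr ⟨hC x hx.1 hy, (gridDim_le hy).trans_lt hx.2⟩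
    have hbd : ∀ x ∈ C, gridDim x = k → gridBdry x ⊆ D := by
      rintro x hx hk y ⟨hy, hy'⟩
      exact Or.inr ⟨hC x hx hy, hk ▸ hy'⟩
    have hex : ∀ x, ∃ ψ' : (κ → ℝ) → ℝ → M, x ∈ C \ C₀ → gridDim x = k →
        ContinuousOn (Function.uncurry ψ') (gridCell x ×ˢ Icc 0 1) ∧
        (∀ y ∈ gridBdry x, ∀ s ∈ Icc (0 : ℝ) 1, ψ' y s = φ y s) ∧
        ∀ y ∈ gridCell x, gridCell y = gridCell x → Q y (ψ' y) := by
      intro x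
      by_cases hx : x ∈ C \ C₀ ∧ gridDim x = k
      · obtain ⟨ψ', h⟩ := step x hx.1 φ
          (hφc.mono (prod_mono (hbd x hx.1.1 hx.2) subset_rfl))
          (fun y hy => hφQ y (hbd x hx.1.1 hx.2 hy))
        exact ⟨ψ', fun _ _ => h⟩
      · exact ⟨φ, fun h1 h2 => absurd ⟨h1, h2⟩ hx⟩
    choose Ψ hΨ using hex
    let φ' : (κ → ℝ) → ℝ → M := fun x => if x ∈ D then φ x else Ψ (gridCentre (gridCode x)) x
    have hcen : ∀ x, x ∈ C \ C₀ → gridCentre (gridCode x) ∈ C \ C₀ := by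
      rintro x ⟨hx, hx0⟩
      have h1 : gridCentre (gridCode x) ∈ gridCell x := by
        rw [← gridCell_gridCentre x]; exact mem_gridCell_self _
      refine ⟨hC x hx h1, fun h => hx0 ?_⟩
      have := hC₀ _ h
      rw [gridCell_gridCentre] at this
      exact this (mem_gridCell_self x)
    have hnew : ∀ x ∈ C₀ ∪ {x ∈ C | gridDim x < k + 1}, x ∉ D → x ∈ C \ C₀ ∧ gridDim x = k := by
      rintro x (hx | hx) hxD
      · exact absurd (Or.inl hx) hxD
      · refine ⟨⟨hx.1, fun h => hxD (Or.inl h)⟩, ?_⟩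
        have : ¬ gridDim x < k := fun h => hxD (Or.inr ⟨hx.1, h⟩)
        have := hx.2
        omega
    have hD' : ∀ x ∈ C₀ ∪ {x ∈ C | gridDim x < k + 1},
        gridCell x ⊆ C₀ ∪ {x ∈ C | gridDim x < k + 1} := by
      rintro x (hx | hx)
      · exact (hC₀ x hx).trans subset_union_left
      · exact fun y hy => Or.inr ⟨hC x hx.1 hy, (gridDim_le hy).trans_lt hx.2⟩
    refine ⟨φ', ?_, ?_, ?_⟩
    · apply continuousOn_of_gridCell hD' isClosed_Icc
      intro x hx
      by_cases hxD : x ∈ D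
      · refine (hφc.mono (prod_mono (hD x hxD) subset_rfl)).congr ?_
        rintro ⟨y, s⟩ ⟨hy, hs⟩
        simp [φ', Function.uncurry, hD x hxD hy]
      · obtain ⟨hxC, hxk⟩ := hnew x hx hxD
        obtain ⟨h1, h2, h3⟩ := hΨ _ (hcen x hxC) ((gridDim_gridCentre x).trans hxk)
        rw [gridCell_gridCentre] at h1
        refine h1.congr ?_
        rintro ⟨y, s⟩ ⟨hy, hs⟩
        simp only [Function.uncurry, φ']
        split_ifs with hyD
        · refine (h2 y ⟨by rw [gridCell_gridCentre]; exact hy, ?_⟩ s hs).symm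
          rw [gridDim_gridCentre]
          by_contra hcon
          have := gridCell_eq_of_gridDim_le hy (not_lt.1 hcon)
          exact hxD (hD y hyD (this ▸ mem_gridCell_self x))
        · have hyk : gridDim x ≤ gridDim y := by
            by_contra hcon
            exact hyD (Or.inr ⟨hC x hxC.1 hy, by omega⟩)
          have : gridCode y = gridCode x := by
            ext i; simp only [gridCode, floor_ceil_eq_of_gridDim_le hy hyk]
          rw [this]
    · intro x hx
      have : x ∈ D := Or.inl hx
      simp only [φ', this, if_true]
      exact hφ0 x hx
    · intro x hx
      by_cases hxD : x ∈ D
      · simp only [φ', hxD, if_true]; exact hφQ x hxD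
      · obtain ⟨hxC, hxk⟩ := hnew x hx hxD
        obtain ⟨h1, h2, h3⟩ := hΨ _ (hcen x hxC) ((gridDim_gridCentre x).trans hxk)
        simp only [φ', hxD, if_false]
        refine h3 x ?_ ?_ <;> rw [gridCell_gridCentre]
        exact mem_gridCell_self x

end Grid

/-- Maps of cubes of dimension at most `k` into `X` with boundary in `A` can be compressed into
`A` relative to the boundary, that is, the pair `(X, A)` is `k`-connected. -/
def Compressible {M : Type*} [TopologicalSpace M] (k : ℕ) (X A : Set M) : Prop :=
  ∀ (ι : Type) [Fintype ι], Fintype.card ι ≤ k → ∀ f : (ι → ℝ) → M,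
    ContinuousOn f (closedBall 0 1) → MapsTo f (closedBall 0 1) X → MapsTo f (sphere 0 1) A →
    ∃ H : (ι → ℝ) → ℝ → M, ContinuousOn (Function.uncurry H) (closedBall 0 1 ×ˢ Icc 0 1) ∧
      (∀ x ∈ closedBall 0 1, ∀ s ∈ Icc (0 : ℝ) 1, H x s ∈ X) ∧
      (∀ x ∈ closedBall 0 1, H x 0 = f x) ∧ (∀ x ∈ closedBall 0 1, H x 1 ∈ A) ∧
      ∀ x ∈ sphere 0 1, ∀ s ∈ Icc (0 : ℝ) 1, H x s = f x

/-- Maps from boundaries of cubes of dimension at most `k` into `Y` extend to the cube. -/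
def SphereExt {M : Type*} [TopologicalSpace M] (k : ℕ) (Y : Set M) : Prop :=
  ∀ (ι : Type) [Fintype ι], Fintype.card ι ≤ k → ∀ f : (ι → ℝ) → M,
    ContinuousOn f (sphere 0 1) → MapsTo f (sphere 0 1) Y →
    ∃ g : (ι → ℝ) → M, ContinuousOn g (closedBall 0 1) ∧ MapsTo g (closedBall 0 1) Y ∧
      ∀ x ∈ sphere 0 1, g x = f x

section

variable {M : Type*} [TopologicalSpace M]

lemma Compressible.mono {k l : ℕ} {X A : Set M} (h : Compressible k X A) (hl : l ≤ k) :
    Compressible l X A :=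
  fun ι _ hι => h ι (hι.trans hl)

lemma SphereExt.mono {k l : ℕ} {X : Set M} (h : SphereExt k X) (hl : l ≤ k) :
    SphereExt l X :=
  fun ι _ hι => h ι (hι.trans hl)

lemma norm_option {ι : Type} [Fintype ι] (z : Option ι → ℝ) :
    ‖z‖ = max |z none| ‖z ∘ some‖ := by
  apply le_antisymm
  · rw [pi_norm_le_iff_of_nonneg (le_max_of_le_left (abs_nonneg _))]
    rintro (_ | i)
    · exact le_max_left _ _
    · exact le_max_of_le_right (norm_le_pi_norm (z ∘ some) i)
  · refine max_le (norm_le_pi_norm z none) ?_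
    rw [pi_norm_le_iff_of_nonneg (norm_nonneg _)]
    exact fun i => norm_le_pi_norm z (some i)

/-- The point of `Option ι → ℝ` with distinguished coordinate `t`. -/
def optionCons {ι : Type} (t : ℝ) (x : ι → ℝ) : Option ι → ℝ := fun o => o.elim t x

lemma continuous_optionCons {ι : Type} :
    Continuous fun p : (ι → ℝ) × ℝ => optionCons p.2 p.1 := by
  refine continuous_pi ?_
  rintro (_ | i)
  · exact continuous_snd
  · exact (continuous_apply i).comp continuous_fst

lemma continuous_comp_some {ι : Type} : Continuous fun z : Option ι → ℝ => z ∘ some :=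
  continuous_pi fun i => continuous_apply (some i)

lemma optionCons_comp_some {ι : Type} (t : ℝ) (x : ι → ℝ) : optionCons t x ∘ some = x := rfl

lemma norm_optionCons {ι : Type} [Fintype ι] (t : ℝ) (x : ι → ℝ) :
    ‖optionCons t x‖ = max |t| ‖x‖ := norm_option _

lemma compressible_of_sphereExt {k : ℕ} {X A : Set M} (hAX : A ⊆ X) (hX : SphereExt (k + 1) X)
    (hA : SphereExt k A) : Compressible k X A := by
  intro ι _ hι f hf hfX hfA
  obtain ⟨β, hβ, hβA, hβf⟩ := hA ι hι f (hf.mono sphere_subset_closedBall) hfA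
  let γ : (Option ι → ℝ) → M := fun z => if z none ≤ 0 then f (z ∘ some) else β (z ∘ some)
  have hnorm : ∀ z ∈ sphere (0 : Option ι → ℝ) 1, z ∘ some ∈ closedBall (0 : ι → ℝ) 1 := by
    intro z hz
    rw [mem_sphere_zero_iff_norm, norm_option] at hz
    rw [mem_closedBall_zero_iff, ← hz]; exact le_max_right _ _
  have hzero : ∀ z ∈ sphere (0 : Option ι → ℝ) 1, z none = 0 →
      z ∘ some ∈ sphere (0 : ι → ℝ) 1 := by
    intro z hz h0
    rw [mem_sphere_zero_iff_norm, norm_option, h0, abs_zero,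
      max_eq_right (norm_nonneg _)] at hz
    simpa using hz
  have hγ : ContinuousOn γ (sphere 0 1) := by
    have hc : sphere (0 : Option ι → ℝ) 1 =
        (sphere 0 1 ∩ {z | z none ≤ 0}) ∪ (sphere 0 1 ∩ {z | 0 ≤ z none}) := by
      rw [← inter_union_distrib_left, eq_comm, inter_eq_left]
      intro z _; exact le_total (z none) 0
    rw [hc]
    refine ContinuousOn.union_of_isClosed ?_ ?_
      (isClosed_sphere.inter (isClosed_le (continuous_apply _) continuous_const))
      (isClosed_sphere.inter (isClosed_le continuous_const (continuous_apply _)))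
    · refine (hf.comp (s := sphere 0 1 ∩ {z | z none ≤ 0})
        (f := fun z : Option ι → ℝ => z ∘ some) continuous_comp_some.continuousOn
        fun z hz => hnorm z hz.1).congr ?_
      intro z hz; exact if_pos hz.2
    · refine (hβ.comp (s := sphere 0 1 ∩ {z | 0 ≤ z none})
        (f := fun z : Option ι → ℝ => z ∘ some) continuous_comp_some.continuousOn
        fun z hz => hnorm z hz.1).congr ?_
      intro z hz
      simp only [γ, Function.comp_apply]
      split_ifs with h
      · exact (hβf _ (hzero z hz.1 (le_antisymm h hz.2))).symm
      · rfl
  have hγX : MapsTo γ (sphere 0 1) X := by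
    intro z hz
    simp only [γ]
    split_ifs
    · exact hfX (hnorm z hz)
    · exact hAX (hβA (hnorm z hz))
  obtain ⟨g, hg, hgX, hgγ⟩ := hX (Option ι) (by simpa using hι) γ hγ hγX
  have hball : ∀ x ∈ closedBall (0 : ι → ℝ) 1, ∀ s ∈ Icc (0 : ℝ) 1,
      optionCons (2 * s - 1) x ∈ closedBall (0 : Option ι → ℝ) 1 := by
    intro x hx s hs
    rw [mem_closedBall_zero_iff, norm_optionCons]
    refine max_le ?_ (by simpa using hx)
    rw [abs_le]; constructor <;> linarith [hs.1, hs.2]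
  have hsph : ∀ x ∈ closedBall (0 : ι → ℝ) 1, ∀ s : ℝ, |2 * s - 1| = 1 →
      optionCons (2 * s - 1) x ∈ sphere (0 : Option ι → ℝ) 1 := by
    intro x hx s hs
    rw [mem_sphere_zero_iff_norm, norm_optionCons, hs]
    exact max_eq_left (by simpa using hx)
  refine ⟨fun x s => g (optionCons (2 * s - 1) x), ?_, ?_, ?_, ?_, ?_⟩
  · refine hg.comp (f := fun p : (ι → ℝ) × ℝ => optionCons (2 * p.2 - 1) p.1) ?_ ?_
    · exact (continuous_optionCons.comp (g := fun p : (ι → ℝ) × ℝ => optionCons p.2 p.1)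
        (f := fun p : (ι → ℝ) × ℝ => (p.1, 2 * p.2 - 1)) (by fun_prop)).continuousOn
    · rintro ⟨x, s⟩ ⟨hx, hs⟩; exact hball x hx s hs
  · intro x hx s hs; exact hgX (hball x hx s hs)
  · intro x hx
    simp only
    rw [hgγ _ (hsph x hx 0 (by norm_num))]
    simp [γ, optionCons]; rfl
  · intro x hx
    simp only
    rw [hgγ _ (hsph x hx 1 (by norm_num))]
    have : γ (optionCons (2 * 1 - 1) x) = β x := by
      simp only [γ, optionCons]; norm_num; rfl
    rw [this]; exact hβA hx
  · intro x hx s hs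
    have h1 : optionCons (2 * s - 1) x ∈ sphere (0 : Option ι → ℝ) 1 := by
      rw [mem_sphere_zero_iff_norm] at hx ⊢
      rw [norm_optionCons, hx, max_eq_right]
      rw [abs_le]; constructor <;> linarith [hs.1, hs.2]
    simp only
    rw [hgγ _ h1]
    simp only [γ, optionCons_comp_some]
    split_ifs
    · rfl
    · exact hβf x hx

section Ball

variable {ι : Type} [Fintype ι]

/-- Attach to a map of the unit ball a homotopy of its boundary as a collar. -/
lemma exists_collar {f : (ι → ℝ) → M} {φ : (ι → ℝ) → ℝ → M}
    (hf : ContinuousOn f (closedBall 0 1))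
    (hφ : ContinuousOn (Function.uncurry φ) (sphere 0 1 ×ˢ Icc 0 1))
    (h0 : ∀ x ∈ sphere 0 1, φ x 0 = f x) :
    ∃ g : (ι → ℝ) → M, ContinuousOn g (closedBall 0 2) ∧ (∀ x ∈ closedBall 0 1, g x = f x) ∧
      (∀ x ∈ sphere 0 1, ∀ s ∈ Icc (0 : ℝ) 1, g ((1 + s) • x) = φ x s) ∧
      ∀ Y : Set M, MapsTo f (closedBall 0 1) Y →
        (∀ x ∈ sphere 0 1, ∀ s ∈ Icc (0 : ℝ) 1, φ x s ∈ Y) → MapsTo g (closedBall 0 2) Y := by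
  let g : (ι → ℝ) → M := fun y => if ‖y‖ ≤ 1 then f y else φ (‖y‖⁻¹ • y) (‖y‖ - 1)
  have hun : ∀ y : ι → ℝ, 1 ≤ ‖y‖ → ‖y‖⁻¹ • y ∈ sphere (0 : ι → ℝ) 1 := by
    intro y hy
    rw [mem_sphere_zero_iff_norm, norm_smul, norm_inv, norm_norm, inv_mul_cancel₀ (by positivity)]
  have hI : ∀ y : ι → ℝ, 1 ≤ ‖y‖ → ‖y‖ ≤ 2 → ‖y‖ - 1 ∈ Icc (0 : ℝ) 1 :=
    fun y h1 h2 => ⟨by linarith, by linarith⟩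
  have hg1 : ∀ x ∈ closedBall 0 1, g x = f x := fun x hx => if_pos (by simpa using hx)
  have hg2 : ∀ y : ι → ℝ, 1 ≤ ‖y‖ → g y = φ (‖y‖⁻¹ • y) (‖y‖ - 1) := by
    intro y hy
    simp only [g]
    split_ifs with h
    · have h1 : ‖y‖ = 1 := le_antisymm h hy
      rw [h1, inv_one, one_smul, sub_self, h0 y (by simpa using h1)]
    · rfl
  refine ⟨g, ?_, hg1, ?_, ?_⟩
  · have hc : closedBall (0 : ι → ℝ) 2 = closedBall 0 1 ∪ (closedBall 0 2 ∩ {y | 1 ≤ ‖y‖}) := by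
      ext y
      simp only [mem_closedBall_zero_iff, mem_union, mem_inter_iff, mem_ofPred_eq]
      constructor
      · intro h; rcases le_total ‖y‖ 1 with h1 | h1
        exacts [Or.inl h1, Or.inr ⟨h, h1⟩]
      · rintro (h | h)
        exacts [h.trans (by norm_num), h.1]
    rw [hc]
    refine ContinuousOn.union_of_isClosed (hf.congr hg1) ?_ isClosed_closedBall
      (isClosed_closedBall.inter (isClosed_le continuous_const continuous_norm))
    have : ContinuousOn (fun y : ι → ℝ => (‖y‖⁻¹ • y, ‖y‖ - 1)) (closedBall 0 2 ∩ {y | 1 ≤ ‖y‖}) := by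
      refine ContinuousOn.prodMk (ContinuousOn.smul (continuous_norm.continuousOn.inv₀ ?_)
        continuousOn_id) (by fun_prop)
      intro y hy
      have : 1 ≤ ‖y‖ := hy.2
      positivity
    refine (hφ.comp this ?_).congr ?_
    · rintro y ⟨hy, hy1⟩
      exact ⟨hun y hy1, hI y hy1 (by simpa using hy)⟩
    · rintro y ⟨hy, hy1⟩; exact hg2 y hy1
  · intro x hx s hs
    have hx' : ‖x‖ = 1 := by simpa using hx
    have hn : ‖(1 + s) • x‖ = 1 + s := by
      rw [norm_smul, hx', mul_one, Real.norm_of_nonneg (by linarith [hs.1])]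
    rw [hg2 _ (by rw [hn]; linarith [hs.1]), hn, smul_smul, inv_mul_cancel₀ (by linarith [hs.1]),
      one_smul]
    simp
  · intro Y hfY hφY y hy
    rcases le_total ‖y‖ 1 with h | h
    · rw [hg1 y (by simpa using h)]; exact hfY (by simpa using h)
    · rw [hg2 y h]; exact hφY _ (hun y h) _ (hI y h (by simpa using hy))

/-- Homotopy extension along `(ball, sphere)`, ending at the collar of a self-map `h`. -/
lemma exists_homotopy_extension {f : (ι → ℝ) → M} {φ : (ι → ℝ) → ℝ → M}
    (hf : ContinuousOn f (closedBall 0 1))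
    (hφ : ContinuousOn (Function.uncurry φ) (sphere 0 1 ×ˢ Icc 0 1))
    (h0 : ∀ x ∈ sphere 0 1, φ x 0 = f x) {h : (ι → ℝ) → ι → ℝ} (hh : Continuous h)
    (hmaps : MapsTo h (closedBall 0 1) (closedBall 0 1)) (hid : ∀ x ∈ sphere 0 1, h x = x) :
    ∃ ψ : (ι → ℝ) → ℝ → M, ContinuousOn (Function.uncurry ψ) (closedBall 0 1 ×ˢ Icc 0 1) ∧
      (∀ x ∈ closedBall 0 1, ψ x 0 = f x) ∧
      (∀ x ∈ sphere 0 1, ∀ s ∈ Icc (0 : ℝ) 1, ψ x s = φ x s) ∧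
      (∀ Y : Set M, MapsTo f (closedBall 0 1) Y →
        (∀ x ∈ sphere 0 1, ∀ s ∈ Icc (0 : ℝ) 1, φ x s ∈ Y) →
        ∀ x ∈ closedBall 0 1, ∀ s ∈ Icc (0 : ℝ) 1, ψ x s ∈ Y) ∧
      ∀ x ∈ closedBall 0 1, h x ∈ sphere (0 : ι → ℝ) 1 → ψ x 1 = φ (h x) 1 := by
  obtain ⟨g, hg, hgf, hgφ, hgY⟩ := exists_collar hf hφ h0
  have hmem : ∀ x ∈ closedBall (0 : ι → ℝ) 1, ∀ s ∈ Icc (0 : ℝ) 1,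
      (1 + s) • ((1 - s) • x + s • h x) ∈ closedBall (0 : ι → ℝ) 2 := by
    intro x hx s hs
    have h1 : (1 - s) • x + s • h x ∈ closedBall (0 : ι → ℝ) 1 :=
      convex_closedBall 0 1 hx (hmaps hx) (by linarith [hs.2]) hs.1 (by ring)
    rw [mem_closedBall_zero_iff] at h1 ⊢
    rw [norm_smul, Real.norm_of_nonneg (by linarith [hs.1])]
    nlinarith [hs.1, hs.2, norm_nonneg ((1 - s) • x + s • h x)]
  refine ⟨fun x s => g ((1 + s) • ((1 - s) • x + s • h x)), ?_, ?_, ?_, ?_, ?_⟩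
  · refine hg.comp (f := fun p : (ι → ℝ) × ℝ => (1 + p.2) • ((1 - p.2) • p.1 + p.2 • h p.1))
      (by fun_prop) ?_
    rintro ⟨x, s⟩ ⟨hx, hs⟩; exact hmem x hx s hs
  · intro x hx; simpa using hgf x hx
  · intro x hx s hs
    simp only
    rw [hid x hx, ← add_smul, sub_add_cancel, one_smul, hgφ x hx s hs]
  · intro Y hfY hφY x hx s hs; exact hgY Y hfY hφY (hmem x hx s hs)
  · intro x hx hhx
    rw [← hgφ _ hhx 1 (by simp)]
    simp

/-- Homotopy extension along `(ball, sphere)` ending in `A`, for a compressible pair. -/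
lemma Compressible.exists_extension {k : ℕ} {X A : Set M} (hXA : Compressible k X A)
    (hι : Fintype.card ι ≤ k) {f : (ι → ℝ) → M} {φ : (ι → ℝ) → ℝ → M}
    (hf : ContinuousOn f (closedBall 0 1))
    (hφ : ContinuousOn (Function.uncurry φ) (sphere 0 1 ×ˢ Icc 0 1))
    (h0 : ∀ x ∈ sphere 0 1, φ x 0 = f x) (hfX : MapsTo f (closedBall 0 1) X)
    (hφX : ∀ x ∈ sphere 0 1, ∀ s ∈ Icc (0 : ℝ) 1, φ x s ∈ X)
    (hφA : ∀ x ∈ sphere 0 1, φ x 1 ∈ A) :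
    ∃ ψ : (ι → ℝ) → ℝ → M, ContinuousOn (Function.uncurry ψ) (closedBall 0 1 ×ˢ Icc 0 1) ∧
      (∀ x ∈ closedBall 0 1, ψ x 0 = f x) ∧
      (∀ x ∈ sphere 0 1, ∀ s ∈ Icc (0 : ℝ) 1, ψ x s = φ x s) ∧
      (∀ x ∈ closedBall 0 1, ∀ s ∈ Icc (0 : ℝ) 1, ψ x s ∈ X) ∧
      ∀ x ∈ closedBall 0 1, ψ x 1 ∈ A := by
  obtain ⟨g, hg, hgf, hgφ, hgY⟩ := exists_collar hf hφ h0
  have hg1 : ∀ x ∈ sphere (0 : ι → ℝ) 1, g ((2 : ℝ) • x) ∈ A := by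
    intro x hx
    have := hgφ x hx 1 (by simp)
    rw [show (1 + 1 : ℝ) = 2 by norm_num] at this
    rw [this]; exact hφA x hx
  have h2 : MapsTo (fun x : ι → ℝ => (2 : ℝ) • x) (closedBall 0 1) (closedBall 0 2) := by
    intro x hx
    rw [mem_closedBall_zero_iff] at hx ⊢
    rw [norm_smul]; norm_num; exact hx
  obtain ⟨G, hG, hGX, hG0, hG1, hGs⟩ := hXA ι hι (fun x => g ((2 : ℝ) • x))
    (hg.comp (by fun_prop) h2) (fun x hx => hgY X hfX hφX (h2 hx)) hg1
  let m : (ι → ℝ) → ℝ → ℝ := fun x s => (1 - s) / 2 + s / max (1 / 2) ‖x‖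
  let c : (ι → ℝ) → ℝ → ℝ := fun x s => s * min 1 (2 * (1 - ‖x‖))
  have hpos : ∀ x : ι → ℝ, 0 < max (1 / 2 : ℝ) ‖x‖ := fun x => lt_max_of_lt_left (by norm_num)
  have hmax : ∀ x : ι → ℝ, ‖x‖ / max (1 / 2) ‖x‖ ≤ 1 :=
    fun x => div_le_one_of_le₀ (le_max_right _ _) (hpos x).le
  have hnm : ∀ x : ι → ℝ, ∀ s ∈ Icc (0 : ℝ) 1,
      ‖m x s • x‖ = (1 - s) / 2 * ‖x‖ + s * (‖x‖ / max (1 / 2) ‖x‖) := by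
    intro x s hs
    rw [norm_smul, Real.norm_of_nonneg]
    · ring
    · have := hpos x
      have := hs.1
      have : 0 ≤ 1 - s := by linarith [hs.2]
      positivity
  have hm : ∀ x ∈ closedBall (0 : ι → ℝ) 1, ∀ s ∈ Icc (0 : ℝ) 1,
      m x s • x ∈ closedBall (0 : ι → ℝ) 1 := by
    intro x hx s hs
    rw [mem_closedBall_zero_iff] at hx ⊢
    rw [hnm x s hs]
    nlinarith [hs.1, hs.2, hmax x, norm_nonneg x]
  have hc : ∀ x ∈ closedBall (0 : ι → ℝ) 1, ∀ s ∈ Icc (0 : ℝ) 1, c x s ∈ Icc (0 : ℝ) 1 := by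
    intro x hx s hs
    rw [mem_closedBall_zero_iff] at hx
    have h1 : (0 : ℝ) ≤ min 1 (2 * (1 - ‖x‖)) := le_min zero_le_one (by linarith)
    have h2 : min 1 (2 * (1 - ‖x‖)) ≤ (1 : ℝ) := min_le_left _ _
    exact ⟨mul_nonneg hs.1 h1, mul_le_one₀ hs.2 h1 h2⟩
  refine ⟨fun x s => G (m x s • x) (c x s), ?_, ?_, ?_, ?_, ?_⟩
  · refine hG.comp (f := fun p : (ι → ℝ) × ℝ => (m p.1 p.2 • p.1, c p.1 p.2)) ?_ ?_
    · have : Continuous fun p : (ι → ℝ) × ℝ => m p.1 p.2 := by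
        refine Continuous.add (by fun_prop) (Continuous.div (by fun_prop) (by fun_prop) ?_)
        exact fun p => (hpos p.1).ne'
      exact Continuous.continuousOn (by fun_prop)
    · rintro ⟨x, s⟩ ⟨hx, hs⟩; exact ⟨hm x hx s hs, hc x hx s hs⟩
  · intro x hx
    have hz : c x 0 = 0 := by simp [c]
    simp only [hz]
    rw [hG0 _ (hm x hx 0 (by simp)), ← hgf x hx]
    simp [m, smul_smul]
  · intro x hx s hs
    have hx' : ‖x‖ = 1 := by simpa using hx
    have hz : c x s = 0 := by simp [c, hx']
    simp only [hz]
    rw [hG0 _ (hm x (sphere_subset_closedBall hx) s hs), ← hgφ x hx s hs, smul_smul]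
    have : 2 * m x s = 1 + s := by
      simp only [m, hx']; norm_num; ring
    rw [this]
  · intro x hx s hs; exact hGX _ (hm x hx s hs) _ (hc x hx s hs)
  · intro x hx
    rcases le_total ‖x‖ (1 / 2) with h | h
    · have : c x 1 = 1 := by
        simp only [c, one_mul]; exact min_eq_left (by linarith)
      simp only [this]; exact hG1 _ (hm x hx 1 (by simp))
    · have hs : m x 1 • x ∈ sphere (0 : ι → ℝ) 1 := by
        rw [mem_sphere_zero_iff_norm, hnm x 1 (by simp), max_eq_right h, div_self (by linarith)]
        simp
      simp only
      rw [hGs _ hs _ (hc x hx 1 (by simp))]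
      exact hg1 _ hs

end Ball

end

section CellParam

variable {κ : Type}

/-- The free coordinates of the grid cell of `x`. -/
abbrev FreeCoord (x : κ → ℝ) : Type := {i // ⌊x i⌋ ≠ ⌈x i⌉}

/-- The affine parametrization of the grid cell of `x` by a cube. -/
noncomputable def cellParam (x : κ → ℝ) (u : FreeCoord x → ℝ) : κ → ℝ :=
  fun i => if h : ⌊x i⌋ ≠ ⌈x i⌉ then ⌊x i⌋ + (1 + u ⟨i, h⟩) / 2 else x i

/-- The affine coordinates on the grid cell of `x`. -/
noncomputable def cellCoord (x : κ → ℝ) (y : κ → ℝ) : FreeCoord x → ℝ :=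
  fun i => 2 * (y i - ⌊x i⌋) - 1

lemma continuous_cellParam (x : κ → ℝ) : Continuous (cellParam x) := by
  refine continuous_pi fun i => ?_
  unfold cellParam
  split_ifs <;> fun_prop

lemma continuous_cellCoord (x : κ → ℝ) : Continuous (cellCoord x) := by
  unfold cellCoord; fun_prop

lemma cellParam_cellCoord {x y : κ → ℝ} (hy : y ∈ gridCell x) :
    cellParam x (cellCoord x y) = y := by
  ext i
  unfold cellParam cellCoord
  split_ifs with h
  · ring
  · have := hy i
    rcases ceil_eq_floor_or (x i) with ⟨h1, h2⟩ | ⟨h1, h2⟩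
    · rw [h1] at this; rw [h2]; exact le_antisymm this.1 this.2
    · omega

variable [Fintype κ]

lemma card_freeCoord (x : κ → ℝ) : Fintype.card (FreeCoord x) = gridDim x :=
  Nat.card_eq_fintype_card.symm

lemma cellParam_mem (x : κ → ℝ) {u : FreeCoord x → ℝ} (hu : u ∈ closedBall 0 1) :
    cellParam x u ∈ gridCell x := by
  rw [mem_closedBall_zero_iff, pi_norm_le_iff_of_nonneg zero_le_one] at hu
  intro i
  unfold cellParam
  split_ifs with h
  · have := abs_le.1 (hu ⟨i, h⟩)
    rcases ceil_eq_floor_or (x i) with ⟨h1, h2⟩ | ⟨h1, h2⟩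
    · omega
    · rw [h1]; push_cast; constructor <;> linarith
  · exact ⟨Int.floor_le _, Int.le_ceil _⟩

lemma cellCoord_mem {x y : κ → ℝ} (hy : y ∈ gridCell x) : cellCoord x y ∈ closedBall 0 1 := by
  rw [mem_closedBall_zero_iff, pi_norm_le_iff_of_nonneg zero_le_one]
  rintro ⟨i, h⟩
  have := hy i
  rw [Real.norm_eq_abs, abs_le]
  unfold cellCoord
  rcases ceil_eq_floor_or (x i) with ⟨h1, h2⟩ | ⟨h1, h2⟩
  · omega
  · rw [h1] at this; push_cast at this; constructor <;> simp only <;> linarith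

lemma mem_unit_sphere_pi {ι : Type} [Fintype ι] {u : ι → ℝ} (hu : u ∈ closedBall 0 1) :
    u ∈ sphere (0 : ι → ℝ) 1 ↔ ∃ i, |u i| = 1 := by
  rw [mem_closedBall_zero_iff, pi_norm_le_iff_of_nonneg zero_le_one] at hu
  rw [mem_sphere_zero_iff_norm]
  constructor
  · intro h
    by_contra! hcon
    have : ‖u‖ < 1 := by
      rw [pi_norm_lt_iff one_pos]
      exact fun i => lt_of_le_of_ne (hu i) (hcon i)
    linarith
  · rintro ⟨i, hi⟩
    apply le_antisymm
    · rwa [pi_norm_le_iff_of_nonneg zero_le_one]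
    · rw [← hi]; exact norm_le_pi_norm u i

lemma cellCoord_mem_sphere {x y : κ → ℝ} (hy : y ∈ gridBdry x) :
    cellCoord x y ∈ sphere (0 : FreeCoord x → ℝ) 1 := by
  rw [mem_unit_sphere_pi (cellCoord_mem hy.1)]
  by_contra! hcon
  refine hy.2.not_ge (Nat.card_mono (s := {i | ⌊x i⌋ ≠ ⌈x i⌉}) (t := {i | ⌊y i⌋ ≠ ⌈y i⌉})
    (Set.toFinite _) ?_)
  intro i hi hi'
  have h1 := hy.1 i
  have h2 := hcon ⟨i, hi⟩
  simp only [cellCoord] at h2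
  rcases ceil_eq_floor_or (x i) with ⟨h3, h4⟩ | ⟨h3, h4⟩
  · exact hi h3.symm
  rcases ceil_eq_floor_or (y i) with ⟨h5, h6⟩ | ⟨h5, h6⟩
  · rw [h3] at h1
    have h7 : ⌊x i⌋ ≤ ⌊y i⌋ := Int.le_floor.2 h1.1
    have h8 : ⌊y i⌋ ≤ ⌊x i⌋ + 1 := by
      have h1' := h1.2; rw [h6] at h1'; exact_mod_cast h1'
    rcases (by omega : ⌊y i⌋ = ⌊x i⌋ ∨ ⌊y i⌋ = ⌊x i⌋ + 1) with h9 | h9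
    · rw [h6, h9] at h2; norm_num at h2
    · rw [h6, h9] at h2; push_cast at h2; norm_num at h2
  · omega

lemma cellParam_mem_bdry (x : κ → ℝ) {u : FreeCoord x → ℝ} (hu : u ∈ sphere 0 1) :
    cellParam x u ∈ gridBdry x := by
  have hb := sphere_subset_closedBall hu
  obtain ⟨⟨i, hi⟩, hi1⟩ := (mem_unit_sphere_pi hb).1 hu
  refine ⟨cellParam_mem x hb, ?_⟩
  by_contra hcon
  have h := floor_ceil_eq_of_gridDim_le (cellParam_mem x hb) (not_lt.1 hcon) i
  have hp : cellParam x u i = ⌊x i⌋ + (1 + u ⟨i, hi⟩) / 2 := by rw [cellParam, dif_pos hi]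
  apply hi
  rw [← h.1, ← h.2, hp]
  rcases abs_eq (zero_le_one) |>.1 hi1 with h1 | h1
  · rw [h1]
    have : (⌊x i⌋ + (1 + 1) / 2 : ℝ) = ((⌊x i⌋ + 1 : ℤ) : ℝ) := by push_cast; ring
    rw [this, Int.floor_intCast, Int.ceil_intCast]
  · rw [h1]
    have : (⌊x i⌋ + (1 + -1) / 2 : ℝ) = ((⌊x i⌋ : ℤ) : ℝ) := by ring
    rw [this, Int.floor_intCast, Int.ceil_intCast]

variable {M : Type*} [TopologicalSpace M]

/-- `Compressible.exists_extension` on a grid cell. -/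
lemma Compressible.exists_extension_gridCell {k : ℕ} {X A : Set M} (hXA : Compressible k X A)
    {x : κ → ℝ} (hx : gridDim x ≤ k) {f : (κ → ℝ) → M} {φ : (κ → ℝ) → ℝ → M}
    (hf : ContinuousOn f (gridCell x))
    (hφ : ContinuousOn (Function.uncurry φ) (gridBdry x ×ˢ Icc 0 1))
    (h0 : ∀ y ∈ gridBdry x, φ y 0 = f y) (hfX : MapsTo f (gridCell x) X)
    (hφX : ∀ y ∈ gridBdry x, ∀ s ∈ Icc (0 : ℝ) 1, φ y s ∈ X)
    (hφA : ∀ y ∈ gridBdry x, φ y 1 ∈ A) :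
    ∃ ψ : (κ → ℝ) → ℝ → M, ContinuousOn (Function.uncurry ψ) (gridCell x ×ˢ Icc 0 1) ∧
      (∀ y ∈ gridCell x, ψ y 0 = f y) ∧
      (∀ y ∈ gridBdry x, ∀ s ∈ Icc (0 : ℝ) 1, ψ y s = φ y s) ∧
      (∀ y ∈ gridCell x, ∀ s ∈ Icc (0 : ℝ) 1, ψ y s ∈ X) ∧
      ∀ y ∈ gridCell x, ψ y 1 ∈ A := by
  obtain ⟨ψ, h1, h2, h3, h4, h5⟩ := hXA.exists_extension (ι := FreeCoord x)
    ((card_freeCoord x).le.trans hx) (f := f ∘ cellParam x) (φ := fun u => φ (cellParam x u))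
    (hf.comp (continuous_cellParam x).continuousOn fun u hu => cellParam_mem x hu)
    (hφ.comp (f := fun p : (FreeCoord x → ℝ) × ℝ => (cellParam x p.1, p.2))
      (((continuous_cellParam x).comp continuous_fst).prodMk continuous_snd).continuousOn
      fun p hp => ⟨cellParam_mem_bdry x hp.1, hp.2⟩)
    (fun u hu => h0 _ (cellParam_mem_bdry x hu)) (fun u hu => hfX (cellParam_mem x hu))
    (fun u hu => hφX _ (cellParam_mem_bdry x hu)) (fun u hu => hφA _ (cellParam_mem_bdry x hu))
  refine ⟨fun y => ψ (cellCoord x y), ?_, ?_, ?_, ?_, ?_⟩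
  · exact h1.comp (f := fun p : (κ → ℝ) × ℝ => (cellCoord x p.1, p.2))
      (((continuous_cellCoord x).comp continuous_fst).prodMk continuous_snd).continuousOn
      fun p hp => ⟨cellCoord_mem hp.1, hp.2⟩
  · intro y hy
    simp only [h2 _ (cellCoord_mem hy), Function.comp_apply, cellParam_cellCoord hy]
  · intro y hy s hs
    simp only [h3 _ (cellCoord_mem_sphere hy) s hs, cellParam_cellCoord hy.1]
  · intro y hy; exact h4 _ (cellCoord_mem hy)
  · intro y hy; exact h5 _ (cellCoord_mem hy)

/-- `exists_homotopy_extension` on a grid cell. -/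
lemma exists_homotopy_extension_gridCell {x : κ → ℝ} {f : (κ → ℝ) → M} {φ : (κ → ℝ) → ℝ → M}
    (hf : ContinuousOn f (gridCell x))
    (hφ : ContinuousOn (Function.uncurry φ) (gridBdry x ×ˢ Icc 0 1))
    (h0 : ∀ y ∈ gridBdry x, φ y 0 = f y) {h : (FreeCoord x → ℝ) → FreeCoord x → ℝ}
    (hh : Continuous h) (hmaps : MapsTo h (closedBall 0 1) (closedBall 0 1))
    (hid : ∀ u ∈ sphere 0 1, h u = u) :
    ∃ ψ : (κ → ℝ) → ℝ → M, ContinuousOn (Function.uncurry ψ) (gridCell x ×ˢ Icc 0 1) ∧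
      (∀ y ∈ gridCell x, ψ y 0 = f y) ∧
      (∀ y ∈ gridBdry x, ∀ s ∈ Icc (0 : ℝ) 1, ψ y s = φ y s) ∧
      (∀ Y : Set M, MapsTo f (gridCell x) Y →
        (∀ y ∈ gridBdry x, ∀ s ∈ Icc (0 : ℝ) 1, φ y s ∈ Y) →
        ∀ y ∈ gridCell x, ∀ s ∈ Icc (0 : ℝ) 1, ψ y s ∈ Y) ∧
      ∀ y ∈ gridCell x, h (cellCoord x y) ∈ sphere (0 : FreeCoord x → ℝ) 1 →
        ψ y 1 = φ (cellParam x (h (cellCoord x y))) 1 := by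
  obtain ⟨ψ, h1, h2, h3, h4, h5⟩ := exists_homotopy_extension (f := f ∘ cellParam x)
    (φ := fun u => φ (cellParam x u))
    (hf.comp (continuous_cellParam x).continuousOn fun u hu => cellParam_mem x hu)
    (hφ.comp (f := fun p : (FreeCoord x → ℝ) × ℝ => (cellParam x p.1, p.2))
      (((continuous_cellParam x).comp continuous_fst).prodMk continuous_snd).continuousOn
      fun p hp => ⟨cellParam_mem_bdry x hp.1, hp.2⟩)
    (fun u hu => h0 _ (cellParam_mem_bdry x hu)) hh hmaps hid
  refine ⟨fun y => ψ (cellCoord x y), ?_, ?_, ?_, ?_, ?_⟩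
  · exact h1.comp (f := fun p : (κ → ℝ) × ℝ => (cellCoord x p.1, p.2))
      (((continuous_cellCoord x).comp continuous_fst).prodMk continuous_snd).continuousOn
      fun p hp => ⟨cellCoord_mem hp.1, hp.2⟩
  · intro y hy
    simp only [h2 _ (cellCoord_mem hy), Function.comp_apply, cellParam_cellCoord hy]
  · intro y hy s hs
    simp only [h3 _ (cellCoord_mem_sphere hy) s hs, cellParam_cellCoord hy.1]
  · intro Y hfY hφY y hy
    exact h4 Y (fun u hu => hfY (cellParam_mem x hu))
      (fun u hu => hφY _ (cellParam_mem_bdry x hu)) _ (cellCoord_mem hy)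
  · intro y hy hhy; exact h5 _ (cellCoord_mem hy) hhy

end CellParam

/-- A self-map of the cube pushing a neighbourhood of the complement of an open orthant to the
boundary. -/
lemma exists_orthant_push_neg {ι : Type} [Fintype ι] :
    ∃ h : (ι → ℝ) → ι → ℝ, Continuous h ∧ MapsTo h (closedBall 0 1) (closedBall 0 1) ∧
      (∀ u ∈ sphere 0 1, h u = u) ∧
      (∀ u ∈ closedBall 0 1, h u ∈ sphere (0 : ι → ℝ) 1 ∨ ∀ i, u i < 0) ∧
      ∀ u ∈ closedBall 0 1, ∀ i, h u i < 0 → u i < 0 := by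
  let w : (ι → ℝ) → ι → ℝ := fun u i => max (2 / 3 * (u i + 1 / 2)) (-2 * (u i + 1 / 2))
  let G : (ι → ℝ) → ℝ := fun u => max ‖w u‖ (1 / 3)
  let h : (ι → ℝ) → ι → ℝ := fun u i => -1 / 2 + (u i + 1 / 2) / G u
  have hwc : Continuous w := by fun_prop
  have hGpos : ∀ u, 0 < G u := fun u => lt_max_of_lt_right (by norm_num)
  have hw0 : ∀ u i, 0 ≤ w u i := by
    intro u i
    rcases le_total 0 (u i + 1 / 2) with h | h
    · exact le_max_of_le_left (by linarith)
    · exact le_max_of_le_right (by linarith)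
  have hwn : ∀ u i, w u i ≤ ‖w u‖ := fun u i => (le_abs_self _).trans (norm_le_pi_norm (w u) i)
  have hwG : ∀ u i, w u i ≤ G u := fun u i => (hwn u i).trans (le_max_left _ _)
  have hb : ∀ u ∈ closedBall (0 : ι → ℝ) 1, ∀ i, |u i| ≤ 1 := by
    intro u hu
    rwa [mem_closedBall_zero_iff, pi_norm_le_iff_of_nonneg zero_le_one] at hu
  have hw1 : ∀ u ∈ closedBall (0 : ι → ℝ) 1, ‖w u‖ ≤ 1 := by
    intro u hu
    rw [pi_norm_le_iff_of_nonneg zero_le_one]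
    intro i
    have := abs_le.1 (hb u hu i)
    rw [Real.norm_of_nonneg (hw0 u i)]
    exact max_le (by linarith) (by linarith)
  have hmaps : MapsTo h (closedBall 0 1) (closedBall 0 1) := by
    intro u hu
    rw [mem_closedBall_zero_iff, pi_norm_le_iff_of_nonneg zero_le_one]
    intro i
    have h1 : 2 / 3 * (u i + 1 / 2) ≤ G u := (le_max_left _ _).trans (hwG u i)
    have h2 : -2 * (u i + 1 / 2) ≤ G u := (le_max_right _ _).trans (hwG u i)
    have h3 : (u i + 1 / 2) / G u ≤ 3 / 2 := by rw [div_le_iff₀ (hGpos u)]; linarith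
    have h4 : -1 / 2 ≤ (u i + 1 / 2) / G u := by rw [le_div_iff₀ (hGpos u)]; linarith
    rw [Real.norm_eq_abs, abs_le]
    constructor <;> simp only [h] <;> linarith
  refine ⟨h, ?_, hmaps, ?_, ?_, ?_⟩
  · refine continuous_pi fun i => continuous_const.add (Continuous.div (by fun_prop) ?_ fun u => (hGpos u).ne')
    exact (continuous_norm.comp hwc).max continuous_const
  · intro u hu
    obtain ⟨i, hi⟩ := (mem_unit_sphere_pi (sphere_subset_closedBall hu)).1 hu
    have : 1 ≤ w u i := by
      rcases abs_eq zero_le_one |>.1 hi with h1 | h1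
      · exact le_max_of_le_left (by rw [h1]; norm_num)
      · exact le_max_of_le_right (by rw [h1]; norm_num)
    have h1 : ‖w u‖ = 1 := le_antisymm (hw1 u (sphere_subset_closedBall hu)) (this.trans (hwn u i))
    have hG : G u = 1 := by simp only [G, h1]; norm_num
    ext j
    simp only [h, hG]; ring
  · intro u hu
    by_cases hcase : ∀ i, u i < 0
    · exact Or.inr hcase
    left
    push Not at hcase
    obtain ⟨j, hj⟩ := hcase
    have hj' : 1 / 3 ≤ ‖w u‖ := le_trans (le_max_of_le_left (by linarith)) (hwn u j)
    have hG : G u = ‖w u‖ := max_eq_left hj'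
    obtain ⟨i, hi⟩ : ∃ i, w u i = ‖w u‖ := by
      by_contra! hcon
      have : ‖w u‖ < ‖w u‖ := by
        rw [pi_norm_lt_iff (by linarith)]
        intro i
        rw [Real.norm_of_nonneg (hw0 u i)]
        exact lt_of_le_of_ne (hwn u i) (hcon i)
      exact lt_irrefl _ this
    rw [mem_unit_sphere_pi (hmaps hu)]
    refine ⟨i, ?_⟩
    simp only [h, hG, ← hi]
    have hpos : 0 < w u i := by rw [hi]; linarith
    rcases max_choice (2 / 3 * (u i + 1 / 2)) (-2 * (u i + 1 / 2)) with h1 | h1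
    · have h2 : w u i = 2 / 3 * (u i + 1 / 2) := h1
      have h3 : (u i + 1 / 2) / w u i = 3 / 2 := by rw [div_eq_iff hpos.ne', h2]; ring
      rw [h3]; norm_num
    · have h2 : w u i = -2 * (u i + 1 / 2) := h1
      have h3 : (u i + 1 / 2) / w u i = -1 / 2 := by rw [div_eq_iff hpos.ne', h2]; ring
      rw [h3]; norm_num
  · intro u hu i hi
    have h1 : (u i + 1 / 2) / G u < 1 / 2 := by simp only [h] at hi; linarith
    rw [div_lt_iff₀ (hGpos u)] at h1
    have : G u ≤ 1 := max_le (hw1 u hu) (by norm_num)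
    linarith

lemma exists_orthant_push {ι : Type} [Fintype ι] {ε : ℝ} (hε : ε = 1 ∨ ε = -1) :
    ∃ h : (ι → ℝ) → ι → ℝ, Continuous h ∧ MapsTo h (closedBall 0 1) (closedBall 0 1) ∧
      (∀ u ∈ sphere 0 1, h u = u) ∧
      (∀ u ∈ closedBall 0 1, h u ∈ sphere (0 : ι → ℝ) 1 ∨ ∀ i, ε * u i < 0) ∧
      ∀ u ∈ closedBall 0 1, ∀ i, ε * h u i < 0 → ε * u i < 0 := by
  obtain ⟨h, h1, h2, h3, h4, h5⟩ := exists_orthant_push_neg (ι := ι)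
  rcases hε with rfl | rfl
  · exact ⟨h, h1, h2, h3, by simpa using h4, by simpa using h5⟩
  · refine ⟨fun u => - h (-u), by fun_prop, ?_, ?_, ?_, ?_⟩
    · intro u hu
      have := h2 (x := -u) (by simpa using hu)
      simpa using this
    · intro u hu
      simp [h3 (-u) (by simpa using hu)]
    · intro u hu
      simpa using h4 (-u) (by simpa using hu)
    · intro u hu
      simpa using h5 (-u) (by simpa using hu)

/-- The non-integral coordinates of `z` lying in the lower (`ε = 1`) or upper (`ε = -1`) half of
their unit interval. -/
def halfCoords {κ : Type} (ε : ℝ) (z : κ → ℝ) : Set κ :=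
  {i | ⌊z i⌋ ≠ ⌈z i⌉ ∧ ε * (2 * (z i - ⌊z i⌋) - 1) < 0}

lemma floor_eq_of_mem_gridCell {κ : Type} {x y : κ → ℝ} (hy : y ∈ gridCell x) {i : κ} (hi : ⌊y i⌋ ≠ ⌈y i⌉) :
    ⌊x i⌋ ≠ ⌈x i⌉ ∧ ⌊y i⌋ = ⌊x i⌋ := by
  have h1 : ⌊x i⌋ ≤ ⌊y i⌋ := Int.le_floor.2 (hy i).1
  have h2 : ⌈y i⌉ ≤ ⌈x i⌉ := Int.ceil_le.2 (hy i).2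
  rcases ceil_eq_floor_or (x i) with ⟨h, -⟩ | ⟨h, -⟩ <;>
    rcases ceil_eq_floor_or (y i) with ⟨h', -⟩ | ⟨h', -⟩ <;> omega

section

variable {κ : Type} [Fintype κ] {M : Type*} [TopologicalSpace M]

lemma ncard_halfCoords_le (ε : ℝ) (z : κ → ℝ) : (halfCoords ε z).ncard ≤ gridDim z :=
  Nat.card_mono (s := halfCoords ε z) (t := {i | ⌊z i⌋ ≠ ⌈z i⌉}) (Set.toFinite _) fun _ h => h.1

/-- Extension of a homotopy over a cell of large dimension, controlling the exceptional points. -/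
lemma exists_extension_halfCoords {ε : ℝ} (hε : ε = 1 ∨ ε = -1) {Y Z : Set M} {n : ℕ}
    {x : κ → ℝ} (hx : n ≤ gridDim x) {f : (κ → ℝ) → M} {φ : (κ → ℝ) → ℝ → M}
    (hf : ContinuousOn f (gridCell x))
    (hφ : ContinuousOn (Function.uncurry φ) (gridBdry x ×ˢ Icc 0 1))
    (h0 : ∀ y ∈ gridBdry x, φ y 0 = f y) (hfY : MapsTo f (gridCell x) Y)
    (hφY : ∀ y ∈ gridBdry x, ∀ s ∈ Icc (0 : ℝ) 1, φ y s ∈ Y)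
    (hφZ : ∀ y ∈ gridBdry x, φ y 1 ∉ Z → n ≤ (halfCoords ε y).ncard) :
    ∃ ψ : (κ → ℝ) → ℝ → M, ContinuousOn (Function.uncurry ψ) (gridCell x ×ˢ Icc 0 1) ∧
      (∀ y ∈ gridCell x, ψ y 0 = f y) ∧
      (∀ y ∈ gridBdry x, ∀ s ∈ Icc (0 : ℝ) 1, ψ y s = φ y s) ∧
      (∀ y ∈ gridCell x, ∀ s ∈ Icc (0 : ℝ) 1, ψ y s ∈ Y) ∧
      ∀ y ∈ gridCell x, gridCell y = gridCell x → ψ y 1 ∉ Z → n ≤ (halfCoords ε y).ncard := by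
  obtain ⟨h, hh, hmaps, hid, hs, hneg⟩ := exists_orthant_push (ι := FreeCoord x) hε
  obtain ⟨ψ, h1, h2, h3, h4, h5⟩ := exists_homotopy_extension_gridCell hf hφ h0 hh hmaps hid
  refine ⟨ψ, h1, h2, h3, h4 Y hfY hφY, ?_⟩
  intro y hy hyx hyZ
  have hdim : gridDim x ≤ gridDim y := gridDim_le (hyx ▸ mem_gridCell_self x)
  have hfl := floor_ceil_eq_of_gridDim_le hy hdim
  have hmem : ∀ i (hi : ⌊x i⌋ ≠ ⌈x i⌉), ε * cellCoord x y ⟨i, hi⟩ < 0 → i ∈ halfCoords ε y := by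
    intro i hi hlt
    refine ⟨by rwa [(hfl i).1, (hfl i).2], ?_⟩
    rw [(hfl i).1]; exact hlt
  rcases hs _ (cellCoord_mem hy) with hsph | hall
  · rw [h5 y hy hsph] at hyZ
    refine (hφZ _ (cellParam_mem_bdry x hsph) hyZ).trans (Set.ncard_le_ncard ?_ (Set.toFinite _))
    rintro i ⟨hi1, hi2⟩
    obtain ⟨hi3, hi4⟩ := floor_eq_of_mem_gridCell (cellParam_mem x (hmaps (cellCoord_mem hy))) hi1
    refine hmem i hi3 (hneg _ (cellCoord_mem hy) ⟨i, hi3⟩ ?_)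
    rw [hi4, cellParam, dif_pos hi3] at hi2
    convert hi2 using 2
    ring
  · refine hx.trans (Nat.card_mono (s := {i | ⌊x i⌋ ≠ ⌈x i⌉}) (t := halfCoords ε y) (Set.toFinite _) ?_)
    exact fun i hi => hmem i hi (hall ⟨i, hi⟩)

lemma Compressible.exists_extension_halfCoords {ε : ℝ} (hε : ε = 1 ∨ ε = -1) {Y Z : Set M} {k : ℕ}
    (hYZ : Compressible k Y (Y ∩ Z)) {x : κ → ℝ} {f : (κ → ℝ) → M} {φ : (κ → ℝ) → ℝ → M}
    (hf : ContinuousOn f (gridCell x))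
    (hφ : ContinuousOn (Function.uncurry φ) (gridBdry x ×ˢ Icc 0 1))
    (h0 : ∀ y ∈ gridBdry x, φ y 0 = f y) (hfY : MapsTo f (gridCell x) Y)
    (hφY : ∀ y ∈ gridBdry x, ∀ s ∈ Icc (0 : ℝ) 1, φ y s ∈ Y)
    (hφZ : ∀ y ∈ gridBdry x, φ y 1 ∉ Z → k + 1 ≤ (halfCoords ε y).ncard) :
    ∃ ψ : (κ → ℝ) → ℝ → M, ContinuousOn (Function.uncurry ψ) (gridCell x ×ˢ Icc 0 1) ∧
      (∀ y ∈ gridCell x, ψ y 0 = f y) ∧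
      (∀ y ∈ gridBdry x, ∀ s ∈ Icc (0 : ℝ) 1, ψ y s = φ y s) ∧
      (∀ y ∈ gridCell x, ∀ s ∈ Icc (0 : ℝ) 1, ψ y s ∈ Y) ∧
      ∀ y ∈ gridCell x, gridCell y = gridCell x → ψ y 1 ∉ Z → k + 1 ≤ (halfCoords ε y).ncard := by
  rcases le_or_gt (gridDim x) k with hk | hk
  · obtain ⟨ψ, h1, h2, h3, h4, h5⟩ := hYZ.exists_extension_gridCell hk hf hφ h0 hfY hφY (by
      intro y hy
      refine ⟨hφY y hy 1 (by simp), ?_⟩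
      by_contra hcon
      have h6 := hφZ y hy hcon
      have h7 := ncard_halfCoords_le ε y
      have h8 := hy.2
      omega)
    exact ⟨ψ, h1, h2, h3, h4, fun y hy _ h => absurd (h5 y hy).2 h⟩
  · exact _root_.exists_extension_halfCoords hε hk hf hφ h0 hfY hφY hφZ

/-- Deformation of a map on `κ → ℝ` whose cells are subordinate to two sets `Y`, `Z`. -/
lemma exists_deformation_halfCoords {Y Z : Set M} {k l : ℕ} (hYZ : Compressible k Y (Y ∩ Z))
    (hZY : Compressible l Z (Z ∩ Y)) {f : (κ → ℝ) → M} (hf : Continuous f)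
    (hcell : ∀ x, MapsTo f (gridCell x) Y ∨ MapsTo f (gridCell x) Z) :
    ∃ Ψ : (κ → ℝ) → ℝ → M, ContinuousOn (Function.uncurry Ψ) (univ ×ˢ Icc 0 1) ∧
      (∀ x, Ψ x 0 = f x) ∧
      (∀ x, MapsTo f (gridCell x) Y → ∀ s ∈ Icc (0 : ℝ) 1, Ψ x s ∈ Y) ∧
      (∀ x, MapsTo f (gridCell x) Z → ∀ s ∈ Icc (0 : ℝ) 1, Ψ x s ∈ Z) ∧
      (∀ x, MapsTo f (gridCell x) (Y ∩ Z) → ∀ s ∈ Icc (0 : ℝ) 1, Ψ x s = f x) ∧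
      (∀ x, Ψ x 1 ∉ Z → k + 1 ≤ (halfCoords 1 x).ncard) ∧
      ∀ x, Ψ x 1 ∉ Y → l + 1 ≤ (halfCoords (-1) x).ncard := by
  have key := exists_extension_of_gridCell (κ := κ) (C₀ := ∅) (C := univ)
    (empty_subset _) (by simp) (by simp)
    (fun x c => c 0 = f x ∧
      (MapsTo f (gridCell x) Y → ∀ s ∈ Icc (0 : ℝ) 1, c s ∈ Y) ∧
      (MapsTo f (gridCell x) Z → ∀ s ∈ Icc (0 : ℝ) 1, c s ∈ Z) ∧
      (MapsTo f (gridCell x) (Y ∩ Z) → ∀ s ∈ Icc (0 : ℝ) 1, c s = f x) ∧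
      (c 1 ∉ Z → k + 1 ≤ (halfCoords 1 x).ncard) ∧ (c 1 ∉ Y → l + 1 ≤ (halfCoords (-1) x).ncard))
    (fun x _ => f x) (by simp) (by simp)
  refine Exists.elim (key ?_) ?_; swap
  · rintro Ψ ⟨h1, -, h2⟩
    exact ⟨Ψ, h1, fun x => (h2 x trivial).1, fun x => (h2 x trivial).2.1,
      fun x => (h2 x trivial).2.2.1, fun x => (h2 x trivial).2.2.2.1,
      fun x => (h2 x trivial).2.2.2.2.1, fun x => (h2 x trivial).2.2.2.2.2⟩
  intro x _ φ hφ hQ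
  have hsub : ∀ {W : Set M}, MapsTo f (gridCell x) W → ∀ y ∈ gridBdry x, MapsTo f (gridCell y) W :=
    fun h y hy => h.mono_left (gridCell_subset hy.1)
  have h0 : ∀ y ∈ gridBdry x, φ y 0 = f y := fun y hy => (hQ y hy).1
  by_cases hY : MapsTo f (gridCell x) Y <;> by_cases hZ : MapsTo f (gridCell x) Z
  · have hYZ' : MapsTo f (gridCell x) (Y ∩ Z) := fun y hy => ⟨hY hy, hZ hy⟩
    refine ⟨fun y _ => f y, (hf.comp continuous_fst).continuousOn, ?_, ?_⟩
    · intro y hy s hs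
      exact ((hQ y hy).2.2.2.1 (hsub hYZ' y hy) s hs).symm
    · intro y hy _
      exact ⟨rfl, fun _ _ _ => hY hy, fun _ _ _ => hZ hy, fun _ _ _ => rfl,
        fun h => absurd (hZ hy) h, fun h => absurd (hY hy) h⟩
  · obtain ⟨ψ, h1, h2, h3, h4, h5⟩ := hYZ.exists_extension_halfCoords (Or.inl rfl) hf.continuousOn
      hφ h0 hY (fun y hy => (hQ y hy).2.1 (hsub hY y hy)) (fun y hy => (hQ y hy).2.2.2.2.1)
    refine ⟨ψ, h1, h3, fun y hy hyx => ⟨h2 y hy, fun _ => h4 y hy, ?_, ?_, h5 y hy hyx,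
      fun h => absurd (h4 y hy 1 (by simp)) h⟩⟩
    · intro h; rw [hyx] at h; exact absurd h hZ
    · intro h; rw [hyx] at h; exact absurd (h.mono_right inter_subset_right) hZ
  · obtain ⟨ψ, h1, h2, h3, h4, h5⟩ := hZY.exists_extension_halfCoords (Or.inr rfl) hf.continuousOn
      hφ h0 hZ (fun y hy => (hQ y hy).2.2.1 (hsub hZ y hy)) (fun y hy => (hQ y hy).2.2.2.2.2)
    refine ⟨ψ, h1, h3, fun y hy hyx => ⟨h2 y hy, ?_, fun _ => h4 y hy, ?_,
      fun h => absurd (h4 y hy 1 (by simp)) h, h5 y hy hyx⟩⟩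
    · intro h; rw [hyx] at h; exact absurd h hY
    · intro h; rw [hyx] at h; exact absurd (h.mono_right inter_subset_left) hY
  · exact absurd (hcell x) (by tauto)

end

lemma lipschitz_clamp (a b : ℝ) : |max (-1) (min 1 a) - max (-1) (min 1 b)| ≤ |a - b| := by
  have h : LipschitzWith 1 fun r : ℝ => max (-1) (min 1 r) :=
    (LipschitzWith.id.const_min 1).const_max (-1)
  simpa [Real.dist_eq] using h.dist_le_mul a b

/-- A continuous map subordinate to an open pair, rescaled so that each grid cell is. -/
lemma exists_subordinate_scale {κ : Type} [Fintype κ] {M : Type*} [TopologicalSpace M]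
    {Y Z : Set M} (hY : IsOpen Y) (hZ : IsOpen Z) {F : (κ → ℝ) → M} (hF : Continuous F)
    (hFYZ : ∀ x, F x ∈ Y ∪ Z) (hcl : ∀ x, F (fun i => max (-1) (min 1 (x i))) = F x) :
    ∃ m : ℕ, 0 < m ∧ ∀ x : κ → ℝ, MapsTo (fun y : κ → ℝ => F fun i => y i / m) (gridCell x) Y ∨
      MapsTo (fun y : κ → ℝ => F fun i => y i / m) (gridCell x) Z := by
  obtain ⟨δ, hδ, hL⟩ := lebesgue_number_lemma_of_metric (isCompact_closedBall (0 : κ → ℝ) 1)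
    (c := fun b : Bool => cond b (F ⁻¹' Y) (F ⁻¹' Z))
    (by rintro (_ | _); exacts [hZ.preimage hF, hY.preimage hF])
    (fun x _ => by
      rcases hFYZ x with h | h
      exacts [mem_iUnion.2 ⟨true, h⟩, mem_iUnion.2 ⟨false, h⟩])
  obtain ⟨m, hm⟩ := exists_nat_gt (1 / δ)
  have hm0 : (0 : ℝ) < m := lt_trans (by positivity) hm
  refine ⟨m, by exact_mod_cast hm0, fun x => ?_⟩
  have hc : (fun i => max (-1) (min 1 (x i / m))) ∈ closedBall (0 : κ → ℝ) 1 := by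
    rw [mem_closedBall_zero_iff, pi_norm_le_iff_of_nonneg zero_le_one]
    intro i
    rw [Real.norm_eq_abs, abs_le]
    exact ⟨le_max_left _ _, max_le (by norm_num) (min_le_left _ _)⟩
  have hball : ∀ y ∈ gridCell x, (fun i => max (-1) (min 1 (y i / m))) ∈
      ball (fun i => max (-1) (min 1 (x i / m)) : κ → ℝ) δ := by
    intro y hy
    rw [mem_ball, dist_pi_lt_iff hδ]
    intro i
    rw [Real.dist_eq]
    refine (lipschitz_clamp _ _).trans_lt ?_
    rw [← sub_div, abs_div, abs_of_pos hm0, div_lt_iff₀ hm0]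
    rw [div_lt_iff₀ hδ] at hm
    refine lt_of_le_of_lt ?_ (mul_comm (m : ℝ) δ ▸ hm)
    have h1 := hy i
    have h2 := Int.floor_le (x i)
    have h3 := Int.le_ceil (x i)
    have h4 : (⌈x i⌉ : ℝ) ≤ ⌊x i⌋ + 1 := by exact_mod_cast Int.ceil_le_floor_add_one (x i)
    rw [abs_le]; constructor <;> linarith
  obtain ⟨b, hb⟩ := hL _ hc
  rcases b with _ | _
  · right; intro y hy
    have := hb (hball y hy)
    simp only [cond_false, mem_preimage, hcl (fun i => y i / m)] at this
    exact this
  · left; intro y hy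
    have := hb (hball y hy)
    simp only [cond_true, mem_preimage, hcl (fun i => y i / m)] at this
    exact this

lemma eq_of_mem_gridCell_of_int {κ : Type} {x y : κ → ℝ} (hy : y ∈ gridCell x) {i : κ} {n : ℤ}
    (hi : x i = n) : y i = n := by
  have := hy i
  rw [hi, Int.floor_intCast, Int.ceil_intCast] at this
  exact le_antisymm this.2 this.1

lemma ncard_le_ncard_some {ι : Type} [Finite ι] (S : Set (Option ι)) :
    S.ncard ≤ (some ⁻¹' S).ncard + 1 := by
  have h : S ⊆ insert none (some '' (some ⁻¹' S)) := by
    rintro (_ | i) hi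
    · exact mem_insert _ _
    · exact mem_insert_of_mem _ ⟨i, hi, rfl⟩
  refine (ncard_le_ncard h (toFinite _)).trans ((ncard_insert_le _ _).trans ?_)
  rw [ncard_image_of_injective _ (Option.some_injective _)]

theorem Compressible.excision {M : Type*} [TopologicalSpace M] {Y Z : Set M} {p : ℕ}
    (hY : IsOpen Y) (hZ : IsOpen Z) (hYZ : Compressible p Y (Y ∩ Z))
    (hZY : Compressible 2 Z (Z ∩ Y)) (hU : Compressible (p + 1) (Y ∪ Z) Z) :
    Compressible (p + 1) Y (Y ∩ Z) := by
  intro ι _ hι α hα hαY hαA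
  obtain ⟨H, hHc, hHU, hH0, hH1, hHs⟩ := hU ι hι α hα (fun x hx => Or.inl (hαY hx))
    (fun x hx => (hαA hx).2)
  let cl : ℝ → ℝ := fun r => max (-1) (min 1 r)
  have hclcl : ∀ r, cl (cl r) = cl r := by
    intro r
    have h1 : -1 ≤ cl r := le_max_left _ _
    have h2 : cl r ≤ 1 := max_le (by norm_num) (min_le_left _ _)
    change max (-1) (min 1 (cl r)) = cl r
    rw [min_eq_right h2, max_eq_right h1]
  have hclball : ∀ x : ι → ℝ, (fun i => cl (x i)) ∈ closedBall (0 : ι → ℝ) 1 := by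
    intro x
    rw [mem_closedBall_zero_iff, pi_norm_le_iff_of_nonneg zero_le_one]
    intro i
    rw [Real.norm_eq_abs, abs_le]
    exact ⟨le_max_left _ _, max_le (by norm_num) (min_le_left _ _)⟩
  have hclid : ∀ x ∈ closedBall (0 : ι → ℝ) 1, (fun i => cl (x i)) = x := by
    intro x hx
    rw [mem_closedBall_zero_iff, pi_norm_le_iff_of_nonneg zero_le_one] at hx
    ext i
    have := abs_le.1 (hx i)
    change max (-1) (min 1 (x i)) = x i
    rw [min_eq_right this.2, max_eq_right this.1]
  have hI : ∀ r : ℝ, max 0 (min 1 r) ∈ Icc (0 : ℝ) 1 :=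
    fun r => ⟨le_max_left _ _, max_le zero_le_one (min_le_left _ _)⟩
  let F : (Option ι → ℝ) → M := fun w => H (fun i => cl (w (some i))) (max 0 (min 1 (w none)))
  have hF : Continuous F := by
    rw [← continuousOn_univ]
    refine hHc.comp (f := fun w : Option ι → ℝ =>
      ((fun i => cl (w (some i)), max 0 (min 1 (w none))) : (ι → ℝ) × ℝ)) ?_ ?_
    · exact Continuous.continuousOn (by fun_prop)
    · exact fun w _ => ⟨hclball _, hI _⟩
  obtain ⟨m, hm, hcell⟩ := exists_subordinate_scale hY hZ hF
    (fun w => hHU _ (hclball _) _ (hI _)) (by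
      intro w
      change H (fun i => cl (cl (w (some i)))) (max 0 (min 1 (cl (w none)))) = _
      have : max 0 (min 1 (cl (w none))) = max 0 (min 1 (w none)) := by
        simp only [cl]
        rcases le_total (w none) 1 with h1 | h1
        · rw [min_eq_right h1]
          rcases le_total (-1) (w none) with h2 | h2
          · rw [max_eq_right h2, min_eq_right h1]
          · rw [max_eq_left h2, max_eq_left (by norm_num), max_eq_left (by linarith)]
        · rw [min_eq_left h1]; norm_num
      simp only [this, hclcl]; rfl)
  have hm0 : (0 : ℝ) < m := by exact_mod_cast hm
  set f : (Option ι → ℝ) → M := fun z => F fun i => z i / m with hfdef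
  have hf : Continuous f := hF.comp (g := F) (f := fun (z : Option ι → ℝ) i => z i / (m : ℝ)) (by fun_prop)
  obtain ⟨Ψ, hΨc, hΨ0, hΨY, hΨZ, hΨYZ, hsm, hlg⟩ := exists_deformation_halfCoords hYZ hZY hf hcell
  -- values of `f` on the boundary of the prism
  have hfbot : ∀ z : Option ι → ℝ, z none = 0 → f z = α fun i => cl (z (some i) / m) := by
    intro z hz
    simp only [f, F, hz]
    norm_num
    exact hH0 _ (hclball _)
  have hftop : ∀ z : Option ι → ℝ, z none = m → f z ∈ Z := by
    intro z hz
    simp only [f, F, hz, div_self hm0.ne']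
    norm_num
    exact hH1 _ (hclball _)
  have hfside : ∀ z : Option ι → ℝ, (∃ i, |z (some i)| = m) →
      f z = α (fun i => cl (z (some i) / m)) ∧
        (fun i => cl (z (some i) / m)) ∈ sphere (0 : ι → ℝ) 1 := by
    rintro z ⟨i, hi⟩
    have hs : (fun i => cl (z (some i) / m)) ∈ sphere (0 : ι → ℝ) 1 := by
      rw [mem_unit_sphere_pi (hclball _)]
      refine ⟨i, ?_⟩
      rcases abs_eq hm0.le |>.1 hi with h | h
      · rw [h, div_self hm0.ne']; simp [cl]
      · rw [h, neg_div, div_self hm0.ne']; simp [cl]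
    exact ⟨hHs _ hs _ (hI _), hs⟩
  let P : (ι → ℝ) → ℝ → Option ι → ℝ := fun x t => optionCons (m * t) (fun i => m * x i)
  have hPc : Continuous fun p : (ι → ℝ) × ℝ => P p.1 p.2 := by
    exact continuous_optionCons.comp (g := fun p : (ι → ℝ) × ℝ => optionCons p.2 p.1)
      (f := fun p : (ι → ℝ) × ℝ => ((fun i => m * p.1 i, m * p.2) : (ι → ℝ) × ℝ)) (by fun_prop)
  have hclP : ∀ x ∈ closedBall (0 : ι → ℝ) 1, ∀ t, (fun i => cl (P x t (some i) / m)) = x := by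
    intro x hx t
    have : ∀ i, P x t (some i) / m = x i := by
      intro i; simp only [P, optionCons, Option.elim]; field_simp
    simp only [this]; exact hclid x hx
  have hΨ1 : ContinuousOn (fun p : (ι → ℝ) × ℝ => Ψ (P p.1 p.2) 1) univ :=
    hΨc.comp (f := fun p : (ι → ℝ) × ℝ => (P p.1 p.2, (1 : ℝ)))
      (hPc.prodMk continuous_const).continuousOn fun p _ => ⟨trivial, by simp⟩
  rw [continuousOn_univ] at hΨ1
  have hcomp : ∀ V : Set M, IsOpen V →
      IsClosed {x ∈ closedBall (0 : ι → ℝ) 1 | ∃ t ∈ Icc (0 : ℝ) 1, Ψ (P x t) 1 ∉ V} := by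
    intro V hV
    have hK : IsCompact ((closedBall (0 : ι → ℝ) 1 ×ˢ Icc (0 : ℝ) 1) ∩
        (fun p : (ι → ℝ) × ℝ => Ψ (P p.1 p.2) 1) ⁻¹' Vᶜ) :=
      ((isCompact_closedBall _ _).prod isCompact_Icc).inter_right (hV.isClosed_compl.preimage hΨ1)
    convert (hK.image continuous_fst).isClosed using 1
    ext x
    constructor
    · rintro ⟨hx, t, ht, h⟩; exact ⟨(x, t), ⟨⟨hx, ht⟩, h⟩, rfl⟩
    · rintro ⟨⟨x, t⟩, ⟨⟨hx, ht⟩, h⟩, rfl⟩; exact ⟨hx, t, ht, h⟩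
  have hdisj : Disjoint {x ∈ closedBall (0 : ι → ℝ) 1 | ∃ t ∈ Icc (0 : ℝ) 1, Ψ (P x t) 1 ∉ Y}
      {x ∈ closedBall (0 : ι → ℝ) 1 | ∃ t ∈ Icc (0 : ℝ) 1, Ψ (P x t) 1 ∉ Z} := by
    rw [Set.disjoint_left]
    rintro x ⟨-, t, -, h⟩ ⟨-, t', -, h'⟩
    have h1 := (hlg _ h).trans (ncard_le_ncard_some _)
    have h2 := (hsm _ h').trans (ncard_le_ncard_some _)
    set L := some ⁻¹' halfCoords (-1) (P x t)
    set S := some ⁻¹' halfCoords 1 (P x t')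
    have hLS : Disjoint L S := by
      rw [Set.disjoint_left]
      rintro i ⟨-, hi⟩ ⟨-, hi'⟩
      simp only [P, optionCons, Option.elim] at hi hi'
      linarith
    have h3 := ncard_union_eq hLS
    have h4 : (L ∪ S).ncard ≤ Fintype.card ι := by
      rw [← Nat.card_eq_fintype_card]; exact ncard_le_card _
    omega
  obtain ⟨τ, hτ0, hτ1, hτI⟩ := exists_continuous_zero_one_of_isClosed (hcomp Y hY) (hcomp Z hZ) hdisj
  let T : (ι → ℝ) → ℝ → ℝ := fun x s => max 0 (2 * s - 1) * τ x
  have hT : ∀ x, ∀ s ∈ Icc (0 : ℝ) 1, T x s ∈ Icc (0 : ℝ) 1 := by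
    intro x s hs
    have h1 : (0 : ℝ) ≤ max 0 (2 * s - 1) := le_max_left _ _
    have h2 : max 0 (2 * s - 1) ≤ 1 := max_le zero_le_one (by linarith [hs.2])
    exact ⟨mul_nonneg h1 (hτI x).1, mul_le_one₀ h2 (hτI x).1 (hτI x).2⟩
  have hend : ∀ x ∈ closedBall (0 : ι → ℝ) 1, ∀ s ∈ Icc (0 : ℝ) 1, Ψ (P x (T x s)) 1 ∈ Y := by
    intro x hx s hs
    by_contra hcon
    have hx0 : τ x = 0 := hτ0 ⟨hx, _, hT x s hs, hcon⟩
    apply hcon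
    refine hΨY _ ?_ 1 (by simp)
    intro y hy
    have hy0 : y none = 0 := by
      have := eq_of_mem_gridCell_of_int hy (i := none) (n := 0)
        (by simp [P, T, hx0, optionCons])
      simpa using this
    rw [hfbot y hy0]
    exact hαY (hclball _)
  have hbot : ∀ x ∈ closedBall (0 : ι → ℝ) 1, ∀ s ∈ Icc (0 : ℝ) 1, Ψ (P x 0) s ∈ Y := by
    intro x hx s hs
    refine hΨY _ ?_ s hs
    intro y hy
    have hy0 : y none = 0 := by
      have := eq_of_mem_gridCell_of_int hy (i := none) (n := 0) (by simp [P, optionCons])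
      simpa using this
    rw [hfbot y hy0]
    exact hαY (hclball _)
  have hs' : ∀ s ∈ Icc (0 : ℝ) 1, min 1 (2 * s) ∈ Icc (0 : ℝ) 1 :=
    fun s hs => ⟨le_min zero_le_one (by linarith [hs.1]), min_le_left _ _⟩
  refine ⟨fun x s => Ψ (P x (T x s)) (min 1 (2 * s)), ?_, ?_, ?_, ?_, ?_⟩
  · have hTc : Continuous fun p : (ι → ℝ) × ℝ => T p.1 p.2 := by fun_prop
    refine hΨc.comp (f := fun p : (ι → ℝ) × ℝ => (P p.1 (T p.1 p.2), min 1 (2 * p.2))) ?_ ?_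
    · exact ((hPc.comp (continuous_fst.prodMk hTc)).prodMk (by fun_prop)).continuousOn
    · exact fun p hp => ⟨trivial, hs' _ hp.2⟩
  · intro x hx s hs
    rcases le_total s (1 / 2) with h | h
    · have : T x s = 0 := by
        simp only [T]; rw [max_eq_left (by linarith), zero_mul]
      simp only [this]; exact hbot x hx _ (hs' s hs)
    · simp only [min_eq_left (show (1 : ℝ) ≤ 2 * s by linarith)]
      exact hend x hx s hs
  · intro x hx
    simp only [mul_zero, min_eq_right zero_le_one, hΨ0]
    have hT0 : T x 0 = 0 := by simp [T]
    rw [hT0, hfbot _ (by simp [P, optionCons]), hclP x hx]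
  · intro x hx
    have h1 : min (1 : ℝ) (2 * 1) = 1 := by norm_num
    simp only [h1]
    refine ⟨hend x hx 1 (by simp), ?_⟩
    by_contra hcon
    have hx1 : τ x = 1 := hτ1 ⟨hx, _, hT x 1 (by simp), hcon⟩
    have hT1 : T x 1 = 1 := by simp only [T, hx1]; norm_num
    apply hcon
    refine hΨZ _ ?_ 1 (by simp)
    intro y hy
    refine hftop y ?_
    have := eq_of_mem_gridCell_of_int hy (i := none) (n := m) (by simp [P, hT1, optionCons])
    simpa using this
  · intro x hx s hs
    have hxb := sphere_subset_closedBall hx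
    obtain ⟨i, hi⟩ := (mem_unit_sphere_pi hxb).1 hx
    have hPi : ∀ t, |P x t (some i)| = m := by
      intro t
      simp only [P, optionCons, Option.elim, abs_mul, hi, abs_of_pos hm0, mul_one]
    have hmap : MapsTo f (gridCell (P x (T x s))) (Y ∩ Z) := by
      intro y hy
      have hyi : |y (some i)| = m := by
        rcases abs_eq hm0.le |>.1 (hPi (T x s)) with h | h
        · have := eq_of_mem_gridCell_of_int hy (n := m) (by simpa using h)
          rw [this]; simp
        · have := eq_of_mem_gridCell_of_int hy (n := -m) (by simpa using h)
          rw [this]; simp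
      obtain ⟨h1, h2⟩ := hfside y ⟨i, hyi⟩
      rw [h1]; exact hαA h2
    simp only [hΨYZ _ hmap _ (hs' s hs)]
    rw [(hfside _ ⟨i, hPi _⟩).1, hclP x hxb]

/-- A pair in which everything is eventually pushed across by excision. -/
theorem Compressible.of_excision {M : Type*} [TopologicalSpace M] {Y Z : Set M}
    (hY : IsOpen Y) (hZ : IsOpen Z) (hYZ : Compressible 1 Y (Y ∩ Z))
    (hZY : Compressible 2 Z (Z ∩ Y)) (hU : ∀ k, Compressible k (Y ∪ Z) Z) (k : ℕ) :
    Compressible k Y (Y ∩ Z) := by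
  induction k with
  | zero => exact hYZ.mono zero_le_one
  | succ k ih => exact ih.excision hY hZ hZY (hU _)

/-- The closed cell containing `x` of the cubical grid of mesh `2 ^ (-j)`. -/
def dyadicCell {κ : Type} (j : ℕ) (x : κ → ℝ) : Set (κ → ℝ) :=
  {y | (2 ^ j : ℝ) • y ∈ gridCell ((2 ^ j : ℝ) • x)}

lemma dyadicCell_succ_subset {κ : Type} (j : ℕ) (x : κ → ℝ) : dyadicCell (j + 1) x ⊆ dyadicCell j x := by
  intro y hy i
  have h1 := hy i
  simp only [Pi.smul_apply, smul_eq_mul, pow_succ] at h1 ⊢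
  set a := (2 : ℝ) ^ j * x i with ha
  have hax : (2 : ℝ) ^ j * 2 * x i = 2 * a := by rw [ha]; ring
  rw [hax] at h1
  have h2 : 2 * ⌊a⌋ ≤ ⌊2 * a⌋ := by
    rw [Int.le_floor]; push_cast; linarith [Int.floor_le a]
  have h3 : ⌈2 * a⌉ ≤ 2 * ⌈a⌉ := by
    rw [Int.ceil_le]; push_cast; linarith [Int.le_ceil a]
  have h2' : (2 * ⌊a⌋ : ℝ) ≤ ⌊2 * a⌋ := by exact_mod_cast h2
  have h3' : (⌈2 * a⌉ : ℝ) ≤ 2 * ⌈a⌉ := by exact_mod_cast h3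
  constructor <;> linarith

lemma mem_dyadicCell_self {κ : Type} (j : ℕ) (x : κ → ℝ) : x ∈ dyadicCell j x := mem_gridCell_self _

lemma dyadicCell_subset {κ : Type} {j : ℕ} {x y : κ → ℝ} (h : y ∈ dyadicCell j x) :
    dyadicCell j y ⊆ dyadicCell j x := fun _ hz => gridCell_subset h hz

section

variable {κ : Type} [Fintype κ] {M : Type*} [TopologicalSpace M]

/-- One stage of the compression: extension from a union of cells to a larger one. -/
lemma exists_compression_stage {X A : Set M} (hXA : ∀ k, Compressible k X A) (hAX : A ⊆ X)
    {C₀ C B : Set (κ → ℝ)} (h₀C : C₀ ⊆ C) (hC₀ : ∀ x ∈ C₀, gridCell x ⊆ C₀)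
    (hC : ∀ x ∈ C, gridCell x ⊆ C) (hB : ∀ x ∈ B, gridCell x ⊆ B) {h : (κ → ℝ) → M}
    (hh : ContinuousOn h C) (hhX : MapsTo h C X) (hhA : MapsTo h (C ∩ B) A)
    {φ₀ : (κ → ℝ) → ℝ → M} (hφ₀ : ContinuousOn (Function.uncurry φ₀) (C₀ ×ˢ Icc 0 1))
    (hQ : ∀ x ∈ C₀, φ₀ x 0 = h x ∧ (∀ s ∈ Icc (0 : ℝ) 1, φ₀ x s ∈ X) ∧ φ₀ x 1 ∈ A ∧
      (x ∈ B → ∀ s ∈ Icc (0 : ℝ) 1, φ₀ x s ∈ A)) :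
    ∃ φ : (κ → ℝ) → ℝ → M, ContinuousOn (Function.uncurry φ) (C ×ˢ Icc 0 1) ∧
      (∀ x ∈ C₀, φ x = φ₀ x) ∧
      ∀ x ∈ C, φ x 0 = h x ∧ (∀ s ∈ Icc (0 : ℝ) 1, φ x s ∈ X) ∧ φ x 1 ∈ A ∧
        (x ∈ B → ∀ s ∈ Icc (0 : ℝ) 1, φ x s ∈ A) := by
  refine exists_extension_of_gridCell h₀C hC₀ hC (fun x c => c 0 = h x ∧
      (∀ s ∈ Icc (0 : ℝ) 1, c s ∈ X) ∧ c 1 ∈ A ∧ (x ∈ B → ∀ s ∈ Icc (0 : ℝ) 1, c s ∈ A))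
      φ₀ hφ₀ hQ ?_
  rintro x ⟨hxC, -⟩ φ hφ hQ
  have hhx : ContinuousOn h (gridCell x) := hh.mono (hC x hxC)
  by_cases hxB : x ∈ B
  · have hsub : gridCell x ⊆ C ∩ B := subset_inter (hC x hxC) (hB x hxB)
    obtain ⟨ψ, h1, h2, h3, h4, -⟩ := exists_homotopy_extension_gridCell hhx hφ
      (fun y hy => (hQ y hy).1) continuous_id (mapsTo_id _) (fun _ _ => rfl)
    have h5 := h4 A (hhA.mono_left hsub) (fun y hy => (hQ y hy).2.2.2 (hsub hy.1).2)
    exact ⟨ψ, h1, h3, fun y hy _ => ⟨h2 y hy, fun s hs => hAX (h5 y hy s hs), h5 y hy 1 (by simp),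
      fun _ => h5 y hy⟩⟩
  · obtain ⟨ψ, h1, h2, h3, h4, h5⟩ := (hXA _).exists_extension_gridCell le_rfl hhx hφ
      (fun y hy => (hQ y hy).1) (hhX.mono_left (hC x hxC)) (fun y hy => (hQ y hy).2.1)
      (fun y hy => (hQ y hy).2.2.1)
    refine ⟨ψ, h1, h3, fun y hy hyx => ⟨h2 y hy, h4 y hy, h5 y hy, fun hyB => absurd ?_ hxB⟩⟩
    exact hB y hyB (hyx ▸ mem_gridCell_self x)

lemma dist_le_of_mem_dyadicCell {j : ℕ} {x y : κ → ℝ} (h : y ∈ dyadicCell j x) :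
    dist y x ≤ (1 / 2) ^ j := by
  rw [dist_pi_le_iff (by positivity)]
  intro i
  have h1 := h i
  simp only [Pi.smul_apply, smul_eq_mul] at h1
  have h2 := Int.floor_le ((2 : ℝ) ^ j * x i)
  have h3 := Int.le_ceil ((2 : ℝ) ^ j * x i)
  have h4 : (⌈(2 : ℝ) ^ j * x i⌉ : ℝ) ≤ ⌊(2 : ℝ) ^ j * x i⌋ + 1 := by
    exact_mod_cast Int.ceil_le_floor_add_one _
  rw [one_div, inv_pow, Real.dist_eq, ← one_div, le_div_iff₀ (by positivity),
    ← abs_of_pos (show (0 : ℝ) < 2 ^ j by positivity), ← abs_mul, abs_le]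
  constructor <;> linarith

lemma exists_compression_dyadic_stage {X A : Set M} (hXA : ∀ k, Compressible k X A) (hAX : A ⊆ X)
    (j : ℕ) {C₀ C B : Set (κ → ℝ)} (h₀C : C₀ ⊆ C) (hC₀ : ∀ x ∈ C₀, dyadicCell j x ⊆ C₀)
    (hC : ∀ x ∈ C, dyadicCell j x ⊆ C) (hB : ∀ x ∈ B, dyadicCell j x ⊆ B) {h : (κ → ℝ) → M}
    (hh : ContinuousOn h C) (hhX : MapsTo h C X) (hhA : MapsTo h (C ∩ B) A)
    {φ₀ : (κ → ℝ) → ℝ → M} (hφ₀ : ContinuousOn (Function.uncurry φ₀) (C₀ ×ˢ Icc 0 1))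
    (hQ : ∀ x ∈ C₀, φ₀ x 0 = h x ∧ (∀ s ∈ Icc (0 : ℝ) 1, φ₀ x s ∈ X) ∧ φ₀ x 1 ∈ A ∧
      (x ∈ B → ∀ s ∈ Icc (0 : ℝ) 1, φ₀ x s ∈ A)) :
    ∃ φ : (κ → ℝ) → ℝ → M, ContinuousOn (Function.uncurry φ) (C ×ˢ Icc 0 1) ∧
      (∀ x ∈ C₀, φ x = φ₀ x) ∧
      ∀ x ∈ C, φ x 0 = h x ∧ (∀ s ∈ Icc (0 : ℝ) 1, φ x s ∈ X) ∧ φ x 1 ∈ A ∧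
        (x ∈ B → ∀ s ∈ Icc (0 : ℝ) 1, φ x s ∈ A) := by
  have hp : (2 ^ j : ℝ) ≠ 0 := by positivity
  let S : (κ → ℝ) → κ → ℝ := fun z => (2 ^ j : ℝ)⁻¹ • z
  let R : (κ → ℝ) → κ → ℝ := fun z => (2 ^ j : ℝ) • z
  have hSR : ∀ z, S (R z) = z := fun z => inv_smul_smul₀ hp z
  have hRS : ∀ z, R (S z) = z := fun z => smul_inv_smul₀ hp z
  have hSc : Continuous S := continuous_const_smul _
  have hRc : Continuous R := continuous_const_smul _
  have hcell : ∀ {D : Set (κ → ℝ)}, (∀ x ∈ D, dyadicCell j x ⊆ D) →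
      ∀ x ∈ S ⁻¹' D, gridCell x ⊆ S ⁻¹' D := by
    intro D hD x hx y hy
    refine hD _ hx ?_
    change R (S y) ∈ gridCell (R (S x))
    rwa [hRS, hRS]
  obtain ⟨φ, h1, h2, h3⟩ := exists_compression_stage hXA hAX (C₀ := S ⁻¹' C₀) (C := S ⁻¹' C)
    (B := S ⁻¹' B) (preimage_mono h₀C) (hcell hC₀) (hcell hC) (hcell hB) (h := h ∘ S)
    (hh.comp hSc.continuousOn fun _ hx => hx) (fun _ hx => hhX hx) (fun _ hx => hhA hx)
    (φ₀ := fun z => φ₀ (S z))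
    (hφ₀.comp (f := fun p : (κ → ℝ) × ℝ => (S p.1, p.2))
      ((hSc.comp continuous_fst).prodMk continuous_snd).continuousOn fun p hp => hp)
    (fun x hx => hQ _ hx)
  have hmem : ∀ {D : Set (κ → ℝ)} {x}, x ∈ D → R x ∈ S ⁻¹' D := by
    intro D x hx; rwa [mem_preimage, hSR]
  refine ⟨fun x => φ (R x), ?_, ?_, ?_⟩
  · exact h1.comp (f := fun p : (κ → ℝ) × ℝ => (R p.1, p.2))
      ((hRc.comp continuous_fst).prodMk continuous_snd).continuousOn
      fun p hp => ⟨hmem hp.1, hp.2⟩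
  · intro x hx; simp only [h2 _ (hmem hx), hSR]
  · intro x hx
    have := h3 _ (hmem hx)
    simpa only [Function.comp_apply, mem_preimage, hSR] using this

/-- Compression of a map defined on an open set of `κ → ℝ`. -/
theorem exists_compression {X A : Set M} (hXA : ∀ k, Compressible k X A) (hAX : A ⊆ X)
    {U B : Set (κ → ℝ)} (hU : IsOpen U) (hB : ∀ j, ∀ x ∈ B, dyadicCell j x ⊆ B) {h : (κ → ℝ) → M}
    (hh : ContinuousOn h U) (hhX : MapsTo h U X) (hhA : MapsTo h (U ∩ B) A) :
    ∃ φ : (κ → ℝ) → ℝ → M, ContinuousOn (Function.uncurry φ) (U ×ˢ Icc 0 1) ∧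
      ∀ x ∈ U, φ x 0 = h x ∧ (∀ s ∈ Icc (0 : ℝ) 1, φ x s ∈ X) ∧ φ x 1 ∈ A ∧
        (x ∈ B → ∀ s ∈ Icc (0 : ℝ) 1, φ x s ∈ A) := by
  classical
  let C : ℕ → Set (κ → ℝ) := fun j => {x | dyadicCell j x ⊆ U}
  have hCU : ∀ j, C j ⊆ U := fun j x hx => hx (mem_dyadicCell_self j x)
  have hCsat : ∀ j, ∀ x ∈ C j, dyadicCell j x ⊆ C j :=
    fun j x hx y hy => (dyadicCell_subset hy).trans hx
  have hCmono : ∀ j, C j ⊆ C (j + 1) := fun j x hx => (dyadicCell_succ_subset j x).trans hx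
  have hCsat' : ∀ j, ∀ x ∈ C j, dyadicCell (j + 1) x ⊆ C j :=
    fun j x hx => (dyadicCell_succ_subset j x).trans (hCsat j x hx)
  have hCnhds : ∀ x ∈ U, ∃ j, C j ∈ 𝓝 x := by
    intro x hx
    obtain ⟨ε, hε, hεU⟩ := Metric.isOpen_iff.1 hU x hx
    obtain ⟨j, hj⟩ := exists_pow_lt_of_lt_one (half_pos hε) (by norm_num : (1 / 2 : ℝ) < 1)
    refine ⟨j, Filter.mem_of_superset (ball_mem_nhds x (half_pos hε)) ?_⟩
    intro y hy z hz
    apply hεU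
    have := dist_le_of_mem_dyadicCell hz
    rw [mem_ball] at hy ⊢
    linarith [dist_triangle z y x]
  let Good : ℕ → ((κ → ℝ) → ℝ → M) → Prop := fun j φ =>
    ContinuousOn (Function.uncurry φ) (C j ×ˢ Icc 0 1) ∧
      ∀ x ∈ C j, φ x 0 = h x ∧ (∀ s ∈ Icc (0 : ℝ) 1, φ x s ∈ X) ∧ φ x 1 ∈ A ∧
        (x ∈ B → ∀ s ∈ Icc (0 : ℝ) 1, φ x s ∈ A)
  have hstart : ∃ φ, Good 0 φ := by
    obtain ⟨φ, h1, -, h3⟩ := exists_compression_dyadic_stage hXA hAX 0 (C₀ := ∅) (C := C 0)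
      (B := B) (empty_subset _) (by simp) (hCsat 0) (hB 0) (hh.mono (hCU 0))
      (hhX.mono_left (hCU 0)) (hhA.mono_left (inter_subset_inter_left _ (hCU 0)))
      (φ₀ := fun x _ => h x) (by simp) (by simp)
    exact ⟨φ, h1, h3⟩
  have hstep : ∀ j φ, Good j φ → ∃ φ', Good (j + 1) φ' ∧ ∀ x ∈ C j, φ' x = φ x := by
    intro j φ hφ
    obtain ⟨φ', h1, h2, h3⟩ := exists_compression_dyadic_stage hXA hAX (j + 1) (C₀ := C j)
      (C := C (j + 1)) (B := B) (hCmono j) (hCsat' j) (hCsat (j + 1)) (hB _) (hh.mono (hCU _))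
      (hhX.mono_left (hCU _)) (hhA.mono_left (inter_subset_inter_left _ (hCU _))) hφ.1 hφ.2
    exact ⟨φ', ⟨h1, h3⟩, h2⟩
  choose! nxt hnxt hnxteq using hstep
  obtain ⟨φ₀, hφ₀⟩ := hstart
  let Φ : ℕ → (κ → ℝ) → ℝ → M := fun j => Nat.rec φ₀ (fun j φ => nxt j φ) j
  have hΦ : ∀ j, Good j (Φ j) := by
    intro j
    induction j with
    | zero => exact hφ₀
    | succ j ih => exact hnxt j _ ih
  have hΦeq : ∀ j k, j ≤ k → ∀ x ∈ C j, x ∈ C k ∧ Φ k x = Φ j x := by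
    intro j k hjk x hx
    induction k, hjk using Nat.le_induction with
    | base => exact ⟨hx, rfl⟩
    | succ k _ ih => exact ⟨hCmono k ih.1, (hnxteq k _ (hΦ k) x ih.1).trans ih.2⟩
  have hex : ∀ x, ∃ j, x ∈ U → x ∈ C j := by
    intro x
    by_cases hx : x ∈ U
    · obtain ⟨j, hj⟩ := hCnhds x hx
      exact ⟨j, fun _ => mem_of_mem_nhds hj⟩
    · exact ⟨0, fun h => absurd h hx⟩
  choose J hJ using hex
  have hlim : ∀ j, ∀ x ∈ C j, Φ (J x) x = Φ j x := by
    intro j x hx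
    rcases le_total j (J x) with hle | hle
    · exact (hΦeq _ _ hle x hx).2
    · exact (hΦeq _ _ hle x (hJ x (hCU j hx))).2.symm
  refine ⟨fun x => Φ (J x) x, ?_, fun x hx => (hΦ _).2 x (hJ x hx)⟩
  rintro ⟨x, t⟩ ⟨hx, ht⟩
  obtain ⟨j, hj⟩ := hCnhds x hx
  have h1 : ContinuousWithinAt (Function.uncurry fun x => Φ (J x) x) (C j ×ˢ Icc 0 1) (x, t) := by
    refine ((hΦ j).1.congr ?_) (x, t) ⟨mem_of_mem_nhds hj, ht⟩
    rintro ⟨y, s⟩ ⟨hy, -⟩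
    exact congrFun (hlim j y hy) s
  refine h1.mono_of_mem_nhdsWithin ?_
  rw [nhdsWithin_prod_eq]
  exact Filter.prod_mem_prod (mem_nhdsWithin_of_mem_nhds hj) self_mem_nhdsWithin

lemma homotopic_of_continuousOn {N : Type*} [TopologicalSpace N] {S : Set M} {T : Set N}
    {f g : C(S, T)} (H : M → ℝ → N) (hH : ContinuousOn (Function.uncurry H) (S ×ˢ Icc 0 1))
    (hT : ∀ x ∈ S, ∀ s ∈ Icc (0 : ℝ) 1, H x s ∈ T) (h0 : ∀ x : S, H x 0 = f x)
    (h1 : ∀ x : S, H x 1 = g x) : f.Homotopic g := by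
  refine ⟨⟨⟨fun p => ⟨H p.2 p.1, hT _ p.2.2 _ p.1.2⟩, ?_⟩, fun x => ?_, fun x => ?_⟩⟩
  · refine Continuous.subtype_mk ?_ _
    exact hH.comp_continuous (f := fun p : unitInterval × S => ((p.2 : M), (p.1 : ℝ)))
      (by fun_prop) fun p => ⟨p.2.2, p.1.2⟩
  · exact Subtype.ext (by simpa using h0 x)
  · exact Subtype.ext (by simpa using h1 x)

/-- A weak equivalence of an open subset into a set with a global chart is a homotopy
equivalence. -/
theorem nonempty_homotopyEquiv_of_compressible {X A : Set M} (hXA : ∀ k, Compressible k X A)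
    (hAX : A ⊆ X) (hA : IsOpen A) {U : Set (κ → ℝ)} (hU : IsOpen U) {p : M → κ → ℝ}
    {q : (κ → ℝ) → M} (hp : ContinuousOn p X) (hq : ContinuousOn q U) (hpU : MapsTo p X U)
    (hqX : MapsTo q U X) (hqp : ∀ x ∈ X, q (p x) = x) :
    Nonempty (ContinuousMap.HomotopyEquiv X A) := by
  obtain ⟨φ, hφ, hQ⟩ := exists_compression hXA hAX hU (B := ∅) (by simp) hq hqX (by rintro _ ⟨_, h⟩; exact h.elim)
  have hr : Continuous fun x : X => φ (p x) 1 :=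
    hφ.comp_continuous (f := fun x : X => (p x, (1 : ℝ)))
      ((hp.domRestrict : Continuous (X.domRestrict p)).prodMk continuous_const)
      fun x => ⟨hpU x.2, by simp⟩
  let r : C(X, A) := ⟨fun x => ⟨φ (p x) 1, (hQ _ (hpU x.2)).2.2.1⟩, hr.subtype_mk _⟩
  let i : C(A, X) := ⟨fun x => ⟨x, hAX x.2⟩, by fun_prop⟩
  have hX : (i.comp r).Homotopic (ContinuousMap.id X) := by
    refine ContinuousMap.Homotopic.symm (homotopic_of_continuousOn (fun x s => φ (p x) s) ?_ ?_ ?_ ?_)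
    · exact hφ.comp (f := fun z : M × ℝ => (p z.1, z.2))
        ((hp.comp continuousOn_fst fun z hz => hz.1).prodMk continuousOn_snd)
        fun z hz => ⟨hpU hz.1, hz.2⟩
    · intro x hx s hs; exact (hQ _ (hpU hx)).2.1 s hs
    · intro x; simp [(hQ _ (hpU x.2)).1, hqp x x.2]
    · intro x; rfl
  let UA : Set (κ → ℝ) := U ∩ q ⁻¹' A
  have hUA : IsOpen UA := hq.isOpen_inter_preimage hU hA
  let cl : ℝ → ℝ := fun t => max 0 (min 1 t)
  have hcl : ∀ t, cl t ∈ Icc (0 : ℝ) 1 :=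
    fun r => ⟨le_max_left _ _, max_le zero_le_one (min_le_left _ _)⟩
  have hcl0 : ∀ t ≤ 0, cl t = 0 := fun t ht => max_eq_left ((min_le_right _ _).trans ht)
  have hcl1 : ∀ t, 1 ≤ t → cl t = 1 := fun t ht => by
    simp only [cl, min_eq_left ht]; norm_num
  have hclc : Continuous cl := by fun_prop
  let B : Set (Option κ → ℝ) := {z | z none ≤ 0 ∨ 1 ≤ z none}
  have hB : ∀ j, ∀ z ∈ B, dyadicCell j z ⊆ B := by
    intro j z hz y hy
    have h1 := hy none
    simp only [Pi.smul_apply, smul_eq_mul] at h1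
    have hpos : (0 : ℝ) < 2 ^ j := by positivity
    rcases hz with hz | hz
    · left
      have h2 : ⌈(2 : ℝ) ^ j * z none⌉ ≤ 0 :=
        Int.ceil_le.2 (by simpa using mul_nonpos_of_nonneg_of_nonpos hpos.le hz)
      have h3 : (⌈(2 : ℝ) ^ j * z none⌉ : ℝ) ≤ 0 := by exact_mod_cast h2
      have h4 := h1.2.trans h3
      by_contra hcon
      have := mul_pos hpos (not_le.1 hcon)
      linarith
    · right
      have h2 : ((2 ^ j : ℤ)) ≤ ⌊(2 : ℝ) ^ j * z none⌋ :=
        Int.le_floor.2 (by push_cast; nlinarith)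
      have h3 : (2 : ℝ) ^ j ≤ ⌊(2 : ℝ) ^ j * z none⌋ := by exact_mod_cast h2
      have h4 := h3.trans h1.1
      by_contra hcon
      have := mul_lt_mul_of_pos_left (not_le.1 hcon) hpos
      linarith
  obtain ⟨χ, hχ, hχQ⟩ := exists_compression hXA hAX (U := (fun z : Option κ → ℝ => z ∘ some) ⁻¹' UA)
    (B := B) (hUA.preimage continuous_comp_some) hB
    (h := fun z => φ (z ∘ some) (cl (z none)))
    (hφ.comp (f := fun z : Option κ → ℝ => (z ∘ some, cl (z none)))
      (continuous_comp_some.prodMk (hclc.comp (continuous_apply _))).continuousOn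
      fun z hz => ⟨hz.1, hcl _⟩)
    (fun z hz => (hQ _ hz.1).2.1 _ (hcl _))
    (by
      rintro z ⟨hz, hz0 | hz1⟩
      · simp only [hcl0 _ hz0, (hQ _ hz.1).1]; exact hz.2
      · simp only [hcl1 _ hz1]; exact (hQ _ hz.1).2.2.1)
  have hpA : ∀ a ∈ A, p a ∈ UA := fun a ha => ⟨hpU (hAX ha), by
    rw [mem_preimage, hqp a (hAX ha)]; exact ha⟩
  let σ : ℝ → ℝ := fun w => max 0 (min 1 (min (3 * w) (3 - 3 * w)))
  have hσ : ∀ w, σ w ∈ Icc (0 : ℝ) 1 := fun w => hcl _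
  have hA' : (r.comp i).Homotopic (ContinuousMap.id A) := by
    refine ContinuousMap.Homotopic.symm (homotopic_of_continuousOn
      (fun a w => χ (optionCons (cl (3 * w - 1)) (p a)) (σ w)) ?_ ?_ ?_ ?_)
    · refine hχ.comp (f := fun z : M × ℝ => (optionCons (cl (3 * z.2 - 1)) (p z.1), σ z.2)) ?_ ?_
      · refine ContinuousOn.prodMk ?_ (by fun_prop)
        refine continuous_optionCons.comp_continuousOn
          (f := fun z : M × ℝ => (p z.1, cl (3 * z.2 - 1))) ?_
        exact ((hp.mono hAX).comp continuousOn_fst fun z hz => hz.1).prodMk (by fun_prop)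
      · intro z hz; exact ⟨hpA _ hz.1, hσ _⟩
    · intro a ha w hw
      have hm : optionCons (cl (3 * w - 1)) (p a) ∈
        (fun z : Option κ → ℝ => z ∘ some) ⁻¹' UA := hpA a ha
      by_cases h1 : 3 * w ≤ 1
      · refine (hχQ _ hm).2.2.2 (Or.inl ?_) _ (hσ _)
        simp [optionCons, hcl0 _ (by linarith : 3 * w - 1 ≤ 0)]
      by_cases h2 : 2 ≤ 3 * w
      · refine (hχQ _ hm).2.2.2 (Or.inr ?_) _ (hσ _)
        simp [optionCons, hcl1 _ (by linarith : 1 ≤ 3 * w - 1)]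
      · have : σ w = 1 := by
          simp only [σ]
          rw [min_eq_left (le_min (by linarith) (by linarith))]; norm_num
        simp only [this]; exact (hχQ _ hm).2.2.1
    · intro a
      have hm : optionCons 0 (p a) ∈ (fun z : Option κ → ℝ => z ∘ some) ⁻¹' UA := hpA a a.2
      have h0 : σ 0 = 0 := by simp [σ]
      have h1 : cl (3 * 0 - 1) = 0 := hcl0 _ (by norm_num)
      simp only [h0, h1, (hχQ _ hm).1, optionCons_comp_some]
      have : cl (optionCons 0 (p a) none) = 0 := hcl0 _ le_rfl
      rw [this, (hQ _ (hpU (hAX a.2))).1, hqp a (hAX a.2)]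
      rfl
    · intro a
      have hm : optionCons 1 (p a) ∈ (fun z : Option κ → ℝ => z ∘ some) ⁻¹' UA := hpA a a.2
      have h0 : σ 1 = 0 := by simp [σ]
      have h1 : cl (3 * 1 - 1) = 1 := hcl1 _ (by norm_num)
      simp only [h0, h1, (hχQ _ hm).1, optionCons_comp_some]
      have : cl (optionCons 1 (p a) none) = 1 := hcl1 _ le_rfl
      rw [this]
      rfl
  exact ⟨⟨r, i, hX, hA'⟩⟩

end

lemma sphereExt_of_convex {F : Type*} [NormedAddCommGroup F] [NormedSpace ℝ F] {Ω : Set F}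
    (hΩ : Convex ℝ Ω) (hne : Ω.Nonempty) (k : ℕ) : SphereExt k Ω := by
  intro ι _ _ γ hγ hγΩ
  obtain ⟨c, hc⟩ := hne
  have hun : ∀ x : ι → ℝ, 1 / 2 ≤ ‖x‖ → ‖x‖⁻¹ • x ∈ sphere (0 : ι → ℝ) 1 := by
    intro x hx
    rw [mem_sphere_zero_iff_norm, norm_smul, norm_inv, norm_norm, inv_mul_cancel₀ (by linarith)]
  let g : (ι → ℝ) → F := fun x => c + max 0 (2 * ‖x‖ - 1) • (γ (‖x‖⁻¹ • x) - c)
  have hg0 : ∀ x, ‖x‖ ≤ 1 / 2 → g x = c := by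
    intro x hx
    simp only [g]
    rw [max_eq_left (by linarith), zero_smul, add_zero]
  refine ⟨g, ?_, ?_, ?_⟩
  · have hcov : closedBall (0 : ι → ℝ) 1 ⊆ {x | ‖x‖ ≤ 1 / 2} ∪ {x | 1 / 2 ≤ ‖x‖} :=
      fun x _ => le_total ‖x‖ (1 / 2)
    refine ContinuousOn.mono ?_ hcov
    refine ContinuousOn.union_of_isClosed (continuousOn_const.congr hg0) ?_
      (isClosed_le continuous_norm continuous_const) (isClosed_le continuous_const continuous_norm)
    refine continuousOn_const.add (ContinuousOn.smul (by fun_prop) (ContinuousOn.sub ?_ continuousOn_const))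
    refine hγ.comp (ContinuousOn.smul (continuous_norm.continuousOn.inv₀ ?_) continuousOn_id)
      fun x hx => hun x hx
    intro x hx
    have : 1 / 2 ≤ ‖x‖ := hx
    linarith
  · intro x hx
    rcases le_total ‖x‖ (1 / 2) with h | h
    · rw [hg0 x h]; exact hc
    · rw [mem_closedBall_zero_iff] at hx
      exact hΩ.add_smul_sub_mem hc (hγΩ (hun x h))
        ⟨le_max_left _ _, max_le zero_le_one (by linarith)⟩
  · intro x hx
    have hx' : ‖x‖ = 1 := by simpa using hx
    simp only [g, hx']; norm_num

/-- Sphere extension in the complement of a `C¹` image of small dimension. -/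
theorem sphereExt_diff_range {F G : Type*} [NormedAddCommGroup F] [NormedSpace ℝ F]
    [FiniteDimensional ℝ F] [NormedAddCommGroup G] [NormedSpace ℝ G] [FiniteDimensional ℝ G]
    {Ω : Set F} (hΩ : Convex ℝ Ω) (hΩo : IsOpen Ω) (hne : Ω.Nonempty) {g : G → F}
    (hg : ContDiff ℝ 1 g) (ho : IsOpen (Ω \ range g)) {k : ℕ}
    (hk : Module.finrank ℝ G + k < Module.finrank ℝ F) : SphereExt k (Ω \ range g) := by
  intro ι _ hι γ hγ hγΩ
  obtain ⟨γ₁, hγ₁, hγ₁Ω, hγ₁γ⟩ := sphereExt_of_convex hΩ hne k ι hι γ hγ (fun x hx => (hγΩ hx).1)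
  obtain ⟨ε₁, hε₁, hε₁Ω⟩ := ((isCompact_closedBall (0 : ι → ℝ) 1).image_of_continuousOn
    hγ₁).exists_thickening_subset_open hΩo hγ₁Ω.image_subset
  obtain ⟨ε₂, hε₂, hε₂Ω⟩ := ((isCompact_sphere (0 : ι → ℝ) 1).image_of_continuousOn
    hγ).exists_thickening_subset_open ho hγΩ.image_subset
  set ε := min ε₁ ε₂ with hεdef
  have hε : 0 < ε := lt_min hε₁ hε₂
  let ρ : (ι → ℝ) → ι → ℝ := fun x => (max 1 ‖x‖)⁻¹ • x
  have hmax : ∀ x : ι → ℝ, 0 < max 1 ‖x‖ := fun x => lt_max_of_lt_left one_pos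
  have hρc : Continuous ρ :=
    Continuous.smul (Continuous.inv₀ (by fun_prop) fun x => (hmax x).ne') continuous_id
  have hρ : ∀ x, ρ x ∈ closedBall (0 : ι → ℝ) 1 := by
    intro x
    rw [mem_closedBall_zero_iff, norm_smul, norm_inv, Real.norm_of_nonneg (hmax x).le,
      inv_mul_le_iff₀ (hmax x), mul_one]
    exact le_max_right _ _
  have hρid : ∀ x ∈ closedBall (0 : ι → ℝ) 1, ρ x = x := by
    intro x hx
    simp only [ρ]
    rw [max_eq_left (by simpa using hx), inv_one, one_smul]
  have hβ : Continuous (γ₁ ∘ ρ) := hγ₁.comp_continuous hρc hρ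
  obtain ⟨Γ, hΓ, hΓβ, -⟩ := hβ.exists_contDiff_approx 1 (ε := fun _ => ε / 2) continuous_const
    (fun _ => half_pos hε)
  have hdense : Dense (range fun p : G × (ι → ℝ) => g p.1 - Γ p.2)ᶜ := by
    refine ContDiff.dense_compl_range_of_finrank_lt_finrank (ContDiff.sub (hg.comp contDiff_fst)
      (ContDiff.comp (by exact_mod_cast hΓ) contDiff_snd)) ?_
    rw [Module.finrank_prod, Module.finrank_fintype_fun_eq_card]
    omega
  obtain ⟨v, hv, hvε⟩ := hdense.exists_dist_lt 0 (half_pos hε)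
  rw [dist_zero_left] at hvε
  have hnot : ∀ x, Γ x + v ∉ range g := by
    rintro x ⟨l, hl⟩
    exact hv ⟨(l, x), by simp [hl]⟩
  have hclose : ∀ x ∈ closedBall (0 : ι → ℝ) 1, Γ x + v ∈ ball (γ₁ x) ε := by
    intro x hx
    have h1 := hΓβ x
    simp only [Function.comp_apply, hρid x hx] at h1
    rw [mem_ball]
    have h2 : dist (Γ x + v) (Γ x) = ‖v‖ := by simp [dist_eq_norm]
    have h3 := dist_triangle (Γ x + v) (Γ x) (γ₁ x)
    have h4 : dist (Γ x) (γ₁ x) < ε / 2 := h1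
    linarith
  let y : (ι → ℝ) → ι → ℝ := fun x => (max (1 / 2) ‖x‖)⁻¹ • x
  have hpos : ∀ x : ι → ℝ, 0 < max (1 / 2) ‖x‖ := fun x => lt_max_of_lt_left (by norm_num)
  have hyc : Continuous y :=
    Continuous.smul (Continuous.inv₀ (by fun_prop) fun x => (hpos x).ne') continuous_id
  have hyn : ∀ x, ‖y x‖ = (max (1 / 2) ‖x‖)⁻¹ * ‖x‖ := by
    intro x
    rw [norm_smul, norm_inv, Real.norm_of_nonneg (hpos x).le]
  have hy1 : ∀ x, y x ∈ closedBall (0 : ι → ℝ) 1 := by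
    intro x
    rw [mem_closedBall_zero_iff, hyn, inv_mul_le_iff₀ (hpos x), mul_one]
    exact le_max_right _ _
  have hy2 : ∀ x : ι → ℝ, 1 / 2 ≤ ‖x‖ → y x ∈ sphere (0 : ι → ℝ) 1 := by
    intro x hx
    rw [mem_sphere_zero_iff_norm, hyn, max_eq_right hx, inv_mul_cancel₀ (by linarith)]
  let l : (ι → ℝ) → ℝ := fun x => max 0 (2 * ‖x‖ - 1)
  refine ⟨fun x => (1 - l x) • (Γ (y x) + v) + l x • γ₁ (y x), ?_, ?_, ?_⟩
  · have h1 : Continuous fun x => γ₁ (y x) := hγ₁.comp_continuous hyc hy1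
    have h2 : Continuous fun x => Γ (y x) := hΓ.continuous.comp hyc
    have hl : Continuous l := by fun_prop
    exact (((continuous_const.sub hl).smul (h2.add continuous_const)).add
      (hl.smul h1)).continuousOn
  · intro x hx
    rw [mem_closedBall_zero_iff] at hx
    rcases le_total ‖x‖ (1 / 2) with h | h
    · have hl : l x = 0 := max_eq_left (by linarith)
      simp only [hl, sub_zero, one_smul, zero_smul, add_zero]
      refine ⟨hε₁Ω (mem_thickening_iff.2 ⟨_, mem_image_of_mem _ (hy1 x), ?_⟩), hnot _⟩
      exact (mem_ball.1 (hclose _ (hy1 x))).trans_le (min_le_left _ _)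
    · have hm : (1 - l x) • (Γ (y x) + v) + l x • γ₁ (y x) ∈ ball (γ₁ (y x)) ε := by
        refine convex_ball _ _ (hclose _ (hy1 x)) (mem_ball_self hε) ?_ (le_max_left _ _) (by ring)
        rw [sub_nonneg]; exact max_le zero_le_one (by linarith)
      refine hε₂Ω (mem_thickening_iff.2 ⟨_, mem_image_of_mem _ (hy2 x h), ?_⟩)
      rw [← hγ₁γ _ (hy2 x h)]
      exact (mem_ball.1 hm).trans_le (min_le_right _ _)
  · intro x hx
    have hx' : ‖x‖ = 1 := by simpa using hx
    have hl : l x = 1 := by simp only [l, hx']; norm_num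
    have hyx : y x = x := by simp only [y, hx']; norm_num
    simp only [hl, hyx, sub_self, zero_smul, one_smul, zero_add]
    exact hγ₁γ x hx

lemma SphereExt.of_retract {M N : Type*} [TopologicalSpace M] [TopologicalSpace N] {X : Set M}
    {U : Set N} {k : ℕ} (hU : SphereExt k U) {p : M → N} {q : N → M} (hp : ContinuousOn p X)
    (hq : ContinuousOn q U) (hpU : MapsTo p X U) (hqX : MapsTo q U X)
    (hqp : ∀ x ∈ X, q (p x) = x) : SphereExt k X := by
  intro ι _ hι γ hγ hγX
  obtain ⟨g, hg, hgU, hgγ⟩ := hU ι hι (p ∘ γ) (hp.comp hγ hγX) (hpU.comp hγX)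
  refine ⟨q ∘ g, hq.comp hg hgU, hqX.comp hgU, fun x hx => ?_⟩
  simp only [Function.comp_apply, hgγ x hx, hqp _ (hγX hx)]

section Flow

variable {F G : Type*} [NormedAddCommGroup F] [NormedSpace ℝ F]
  [NormedAddCommGroup G] [NormedSpace ℝ G] [FiniteDimensional ℝ G]

/-- An injective immersion is bi-Lipschitz on compact sets. -/
lemma exists_mul_norm_sub_le_of_injective {g : G → F} (hg : ContDiff ℝ 1 g)
    (hinj : Function.Injective g) (hd : ∀ x, Function.Injective (fderiv ℝ g x))
    {K : Set G} (hK : IsCompact K) :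
    ∃ c > 0, ∀ x ∈ K, ∀ y ∈ K, c * ‖x - y‖ ≤ ‖g x - g y‖ := by
  have key : ∃ c > 0, ∀ p ∈ K ×ˢ K, c * ‖p.1 - p.2‖ ≤ ‖g p.1 - g p.2‖ := by
    refine (hK.prod hK).induction_on (p := fun S => ∃ c > 0, ∀ p ∈ S,
      c * ‖p.1 - p.2‖ ≤ ‖g p.1 - g p.2‖) ⟨1, one_pos, by simp⟩ ?_ ?_ ?_
    · rintro s t hst ⟨c, hc, h⟩
      exact ⟨c, hc, fun p hp => h p (hst hp)⟩
    · rintro s t ⟨c, hc, h⟩ ⟨c', hc', h'⟩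
      refine ⟨min c c', lt_min hc hc', ?_⟩
      rintro p (hp | hp)
      · exact (mul_le_mul_of_nonneg_right (min_le_left _ _) (norm_nonneg _)).trans (h p hp)
      · exact (mul_le_mul_of_nonneg_right (min_le_right _ _) (norm_nonneg _)).trans (h' p hp)
    · rintro ⟨a, b⟩ -
      suffices ∃ c > 0, ∀ᶠ p in 𝓝 (a, b), c * ‖p.1 - p.2‖ ≤ ‖g p.1 - g p.2‖ by
        obtain ⟨c, hc, h⟩ := this
        exact ⟨_, mem_nhdsWithin_of_mem_nhds h, c, hc, fun p hp => hp⟩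
      by_cases hab : a = b
      · subst hab
        obtain ⟨κ, hκ, hanti⟩ := LinearMap.exists_antilipschitzWith
          (fderiv ℝ g a : G →ₗ[ℝ] F) (LinearMap.ker_eq_bot.2 (hd a))
        obtain ⟨k, hk, hanti'⟩ : ∃ k : ℝ, 0 < k ∧ ∀ v, ‖v‖ ≤ k * ‖fderiv ℝ g a v‖ :=
          ⟨κ, hκ, fun v => by simpa using hanti.le_mul_dist v 0⟩
        have hs := (hg.contDiffAt (x := a)).hasStrictFDerivAt one_ne_zero
        refine ⟨(2 * k)⁻¹, by positivity, ?_⟩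
        filter_upwards [hs.isLittleO.def (show (0 : ℝ) < (2 * k)⁻¹ by positivity)] with p hp
        have h2 := norm_sub_norm_le (fderiv ℝ g a (p.1 - p.2)) (g p.1 - g p.2)
        rw [norm_sub_rev _ (g p.1 - g p.2)] at h2
        have h3 : k⁻¹ * ‖p.1 - p.2‖ ≤ ‖fderiv ℝ g a (p.1 - p.2)‖ := by
          rw [inv_mul_le_iff₀ hk]
          exact hanti' _
        have h4 : k⁻¹ = (2 * k)⁻¹ + (2 * k)⁻¹ := by ring
        rw [h4, add_mul] at h3
        linarith
      · have hδ : 0 < ‖g a - g b‖ := norm_pos_iff.2 (sub_ne_zero.2 (hinj.ne hab))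
        refine ⟨‖g a - g b‖ / 2 / (‖a - b‖ + 1), by positivity, ?_⟩
        have hc1 : Continuous fun p : G × G => ‖p.1 - p.2‖ := by fun_prop
        have hc2 : Continuous fun p : G × G => ‖g p.1 - g p.2‖ := by
          have := hg.continuous; fun_prop
        filter_upwards [hc1.continuousAt.eventually_lt continuousAt_const
            (show ‖(a, b).1 - (a, b).2‖ < ‖a - b‖ + 1 by simp),
          continuousAt_const.eventually_lt hc2.continuousAt
            (show ‖g a - g b‖ / 2 < ‖g (a, b).1 - g (a, b).2‖ by simpa using hδ)] with p h1 h2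
        refine le_trans ?_ h2.le
        rw [div_mul_eq_mul_div, div_le_iff₀ (by positivity)]
        exact mul_le_mul_of_nonneg_left h1.le (by positivity)
  obtain ⟨c, hc, h⟩ := key
  exact ⟨c, hc, fun x hx y hy => h (x, y) ⟨hx, hy⟩⟩

variable [FiniteDimensional ℝ F]

/-- The radial vector field on an embedded ball extends to a compactly supported Lipschitz
vector field. -/
lemma exists_lipschitz_radial_extension {g : G → F} (hg : ContDiff ℝ 2 g)
    (hinj : Function.Injective g) (hd : ∀ x, Function.Injective (fderiv ℝ g x)) (R : ℝ) :
    ∃ (w : F → F) (C : NNReal) (B : ℝ), LipschitzWith C w ∧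
      (∀ y ∈ closedBall 0 R, w (g y) = fderiv ℝ g y y) ∧ ∀ z, B ≤ ‖z‖ → w z = 0 := by
  have hK : IsCompact (closedBall (0 : G) R) := isCompact_closedBall _ _
  have hg1 : ContDiff ℝ 1 g := hg.of_le (by norm_num)
  obtain ⟨c, hc, hlow⟩ := exists_mul_norm_sub_le_of_injective hg1 hinj hd hK
  have hdc : ContDiff ℝ 1 fun y => fderiv ℝ g y y :=
    (hg.contDiff_fderiv_apply (m := 1) (by norm_num)).comp
      (contDiff_id.prodMk contDiff_id)
  obtain ⟨κ, hκ⟩ := hdc.contDiffOn.exists_lipschitzOnWith one_ne_zero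
    (convex_closedBall (0 : G) R) hK
  obtain ⟨B₀, hB₀⟩ := (hK.image hg.continuous).isBounded.exists_norm_le
  obtain ⟨D, hD⟩ := (hK.image hdc.continuous).isBounded.exists_norm_le
  have hB₀' : ∀ y ∈ closedBall (0 : G) R, ‖g y‖ ≤ B₀ := fun y hy => hB₀ _ (mem_image_of_mem _ hy)
  have hD' : ∀ y ∈ closedBall (0 : G) R, ‖fderiv ℝ g y y‖ ≤ D :=
    fun y hy => hD _ (mem_image_of_mem (fun y => fderiv ℝ g y y) hy)
  set S : Set F := g '' closedBall 0 R ∪ {z | B₀ + 1 ≤ ‖z‖} with hS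
  classical
  let w₀ : F → F := fun z => if B₀ + 1 ≤ ‖z‖ then 0 else
    fderiv ℝ g (Function.invFun g z) (Function.invFun g z)
  have hw₀ : ∀ y ∈ closedBall (0 : G) R, w₀ (g y) = fderiv ℝ g y y := by
    intro y hy
    have := hB₀' y hy
    simp only [w₀]
    rw [if_neg (by linarith), Function.leftInverse_invFun hinj]
  have hw₀' : ∀ z, B₀ + 1 ≤ ‖z‖ → w₀ z = 0 := fun z hz => if_pos hz
  set L : ℝ := max (κ / c) (max D 0) with hL
  have hL0 : 0 ≤ L := (le_max_right D 0).trans (le_max_right _ _)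
  have hcross : ∀ y ∈ closedBall (0 : G) R, ∀ z, B₀ + 1 ≤ ‖z‖ →
      ‖fderiv ℝ g y y‖ ≤ L * dist (g y) z := by
    intro y hy z hz
    have h1 : 1 ≤ dist (g y) z := by
      have := norm_sub_norm_le z (g y)
      rw [dist_comm, dist_eq_norm]
      linarith [hB₀' y hy]
    calc ‖fderiv ℝ g y y‖ ≤ D := hD' y hy
      _ ≤ L := (le_max_left D 0).trans (le_max_right _ _)
      _ ≤ L * dist (g y) z := le_mul_of_one_le_right hL0 h1
  have hlip : LipschitzOnWith L.toNNReal w₀ S := by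
    refine LipschitzOnWith.of_dist_le_mul ?_
    rw [Real.coe_toNNReal _ hL0]
    rintro _ (⟨y, hy, rfl⟩ | hz) _ (⟨y', hy', rfl⟩ | hz')
    · rw [hw₀ y hy, hw₀ y' hy']
      have h1 := hκ.dist_le_mul y hy y' hy'
      have h2 := hlow y hy y' hy'
      rw [← dist_eq_norm, ← dist_eq_norm, ← le_div_iff₀' hc] at h2
      calc _ ≤ κ * dist y y' := h1
        _ ≤ κ * (dist (g y) (g y') / c) := by gcongr
        _ = κ / c * dist (g y) (g y') := by ring
        _ ≤ _ := by gcongr; exact le_max_left _ _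
    · rw [hw₀ y hy, hw₀' _ hz', dist_zero_right]
      exact hcross y hy _ hz'
    · rw [hw₀ y' hy', hw₀' _ hz, dist_zero_left, dist_comm]
      exact hcross y' hy' _ hz
    · rw [hw₀' _ hz, hw₀' _ hz', dist_self]
      positivity
  obtain ⟨w, hw, hww⟩ := hlip.extend_finite_dimension
  refine ⟨w, _, B₀ + 1, hw, fun y hy => ?_, fun z hz => ?_⟩
  · rw [← hww (Or.inl (mem_image_of_mem _ hy)), hw₀ y hy]
  · rw [← hww (Or.inr hz), hw₀' z hz]

/-- Flow of a compactly supported Lipschitz vector field on a bounded interval of times. -/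
lemma exists_flow_of_lipschitz {w : F → F} {C : NNReal} {B : ℝ} (hw : LipschitzWith C w)
    (hB : ∀ z, B ≤ ‖z‖ → w z = 0) {T : ℝ} (hT : 0 ≤ T) :
    ∃ ψ : ℝ → F → F, ContinuousOn (Function.uncurry ψ) (Icc 0 T ×ˢ univ) ∧ (∀ z, ψ 0 z = z) ∧
      (∀ z, ∀ s ∈ Icc 0 T, HasDerivWithinAt (fun t => ψ t z) (w (ψ s z)) (Icc 0 T) s) ∧
      ∀ s ∈ Icc 0 T, ∀ z, B ≤ ‖z‖ → ψ s z = z := by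
  have hbdd : ∃ L : NNReal, ∀ z, ‖w z‖ ≤ L := by
    obtain ⟨L, hL⟩ := ((isCompact_closedBall (0 : F) B).image hw.continuous).isBounded.exists_norm_le
    refine ⟨L.toNNReal, fun z => ?_⟩
    rcases le_total B ‖z‖ with h | h
    · rw [hB z h, norm_zero]; exact NNReal.coe_nonneg _
    · exact (hL _ (mem_image_of_mem _ (by simpa using h))).trans (Real.le_coe_toNNReal L)
  obtain ⟨L, hL⟩ := hbdd
  have hex : ∀ z : F, ∃ α : ℝ → F, α 0 = z ∧
      ∀ t ∈ Icc 0 T, HasDerivWithinAt α (w (α t)) (Icc 0 T) t := by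
    intro z
    have hPL : IsPicardLindelof (fun _ => w) (tmin := 0) (tmax := T) ⟨0, le_rfl, hT⟩ z
        (L * T.toNNReal) 0 L C := by
      refine IsPicardLindelof.of_time_independent (fun x _ => hL x) hw.lipschitzOnWith ?_
      simp [hT]
    exact hPL.exists_eq_forall_mem_Icc_hasDerivWithinAt₀
  choose α hα0 hα using hex
  have hcont : ∀ z, ContinuousOn (α z) (Icc 0 T) := fun z t ht => (hα z t ht).continuousWithinAt
  have hright : ∀ z, ∀ t ∈ Ico 0 T, HasDerivWithinAt (α z) (w (α z t)) (Ici t) t := by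
    intro z t ht
    have := (hα z t (Ico_subset_Icc_self ht)).mono (Icc_subset_Icc_left ht.1)
    exact this.mono_of_mem_nhdsWithin (Icc_mem_nhdsGE ht.2)
  refine ⟨fun t z => α z t, ?_, hα0, fun z s hs => hα z s hs, ?_⟩
  · refine continuousOn_prod_of_continuousOn_lipschitzOnWith' _ (Real.exp (C * T)).toNNReal
      (fun t ht => ?_) fun z _ => hcont z
    refine LipschitzOnWith.of_dist_le_mul fun z _ z' _ => ?_
    have h := dist_le_of_trajectories_ODE (v := fun _ => w) (fun _ => hw) (hcont z) (hright z)
      (hcont z') (hright z') le_rfl t ht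
    rw [hα0, hα0, sub_zero] at h
    rw [Real.coe_toNNReal _ (Real.exp_nonneg _), mul_comm]
    refine h.trans (mul_le_mul_of_nonneg_left ?_ dist_nonneg)
    exact Real.exp_le_exp.2 (mul_le_mul_of_nonneg_left ht.2 C.coe_nonneg)
  · intro s hs z hz
    have h := dist_le_of_trajectories_ODE (v := fun _ => w) (f := α z) (g := fun _ => z)
      (fun _ => hw) (hcont z) (hright z) continuousOn_const (fun t _ => by
        rw [hB z hz]; exact hasDerivWithinAt_const _ _ _) (le_of_eq (by rw [hα0, dist_self])) s hs
    rw [zero_mul] at h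
    exact dist_le_zero.1 h

/-- A flow expanding an embedded ball radially. -/
lemma exists_expanding_flow {g : G → F} (hg : ContDiff ℝ 2 g)
    (hinj : Function.Injective g) (hd : ∀ x, Function.Injective (fderiv ℝ g x)) (R : ℝ)
    {T : ℝ} (hT : 0 ≤ T) :
    ∃ (ψ : ℝ → F → F) (B : ℝ), ContinuousOn (Function.uncurry ψ) (Icc 0 T ×ˢ univ) ∧
      (∀ z, ψ 0 z = z) ∧ (∀ s ∈ Icc 0 T, ∀ z, B ≤ ‖z‖ → ψ s z = z) ∧
      ∀ s ∈ Icc 0 T, ∀ z, ∀ y ∈ closedBall 0 R, ψ s z = g y → z = g (Real.exp (-s) • y) := by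
  obtain ⟨w, C, B, hw, hwg, hB⟩ := exists_lipschitz_radial_extension hg hinj hd R
  obtain ⟨ψ, hψ, hψ0, hψd, hψB⟩ := exists_flow_of_lipschitz hw hB hT
  refine ⟨ψ, B, hψ, hψ0, hψB, fun s hs z y hy hsy => ?_⟩
  have hsub : Icc 0 s ⊆ Icc 0 T := Icc_subset_Icc_right hs.2
  have hder : ∀ t, HasDerivAt (fun t => g (Real.exp (t - s) • y))
      (fderiv ℝ g (Real.exp (t - s) • y) (Real.exp (t - s) • y)) t := by
    intro t
    have h1 : HasDerivAt (fun t => Real.exp (t - s) • y) (Real.exp (t - s) • y) t := by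
      have := (((hasDerivAt_id t).sub_const s).exp).smul_const y
      simpa using this
    exact ((hg.differentiable (by norm_num)) _).hasFDerivAt.comp_hasDerivAt t h1
  have huniq := ODE_solution_unique_of_mem_Icc_left (v := fun _ => w) (s := fun _ => univ)
    (K := C) (f := fun t => ψ t z) (g := fun t => g (Real.exp (t - s) • y)) (a := 0) (b := s)
    (fun _ _ => hw.lipschitzOnWith)
    (fun t ht => ((hψd z t (hsub ht)).mono hsub).continuousWithinAt)
    (fun t ht => (((hψd z t (hsub (Ioc_subset_Icc_self ht))).mono hsub).mono
      (Icc_subset_Icc_right ht.2)).mono_of_mem_nhdsWithin (Icc_mem_nhdsLE ht.1))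
    (fun _ _ => mem_univ _)
    (fun t _ => (hder t).continuousAt.continuousWithinAt)
    (fun t ht => by
      have hmem : Real.exp (t - s) • y ∈ closedBall (0 : G) R := by
        rw [mem_closedBall_zero_iff] at hy ⊢
        rw [norm_smul, Real.norm_of_nonneg (Real.exp_nonneg _)]
        refine (mul_le_of_le_one_left (norm_nonneg _) ?_).trans hy
        rw [Real.exp_le_one_iff]; linarith [ht.2]
      rw [hwg _ hmem]
      exact (hder t).hasDerivWithinAt)
    (fun _ _ => mem_univ _) (by simp [hsy])
  have h0 := huniq (left_mem_Icc.2 hs.1)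
  simpa [hψ0] using h0

end Flow

lemma sphereExt_of_flow {M : Type*} [TopologicalSpace M] {W P : Set M} {k : ℕ}
    (hP : SphereExt k P) (hWP : W ⊆ P)
    (h : ∀ C ⊆ P, IsCompact C → ∃ ψ : ℝ → M → M,
      ContinuousOn (Function.uncurry ψ) (Icc 0 1 ×ˢ univ) ∧ (∀ z, ψ 0 z = z) ∧
      (∀ s ∈ Icc (0 : ℝ) 1, ∀ z ∈ W, ψ s z ∈ W) ∧ ∀ z ∈ C, ψ 1 z ∈ W) : SphereExt k W := by
  intro ι _ hι γ hγ hγW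
  obtain ⟨g, hg, hgP, hgγ⟩ := hP ι hι γ hγ (hγW.mono_right hWP)
  obtain ⟨ψ, hψ, hψ0, hψW, hψC⟩ := h (g '' closedBall 0 1) hgP.image_subset
    ((isCompact_closedBall _ _).image_of_continuousOn hg)
  let y : (ι → ℝ) → ι → ℝ := fun x => (max (1 / 2) ‖x‖)⁻¹ • x
  have hpos : ∀ x : ι → ℝ, 0 < max (1 / 2) ‖x‖ := fun x => lt_max_of_lt_left (by norm_num)
  have hyc : Continuous y :=
    Continuous.smul (Continuous.inv₀ (by fun_prop) fun x => (hpos x).ne') continuous_id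
  have hyn : ∀ x, ‖y x‖ = (max (1 / 2) ‖x‖)⁻¹ * ‖x‖ := by
    intro x
    rw [norm_smul, norm_inv, Real.norm_of_nonneg (hpos x).le]
  have hy1 : ∀ x, y x ∈ closedBall (0 : ι → ℝ) 1 := by
    intro x
    rw [mem_closedBall_zero_iff, hyn, inv_mul_le_iff₀ (hpos x), mul_one]
    exact le_max_right _ _
  have hy2 : ∀ x : ι → ℝ, 1 / 2 ≤ ‖x‖ → y x ∈ sphere (0 : ι → ℝ) 1 := by
    intro x hx
    rw [mem_sphere_zero_iff_norm, hyn, max_eq_right hx, inv_mul_cancel₀ (by linarith)]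
  let l : (ι → ℝ) → ℝ := fun x => max 0 (min 1 (2 - 2 * ‖x‖))
  have hl : Continuous l := by fun_prop
  have hl01 : ∀ x, l x ∈ Icc (0 : ℝ) 1 := fun x =>
    ⟨le_max_left _ _, max_le zero_le_one (min_le_left _ _)⟩
  refine ⟨fun x => ψ (l x) (g (y x)), ?_, ?_, ?_⟩
  · exact Continuous.continuousOn
      (hψ.comp_continuous (f := fun x => (l x, g (y x)))
        (hl.prodMk (hg.comp_continuous hyc hy1)) fun x => ⟨hl01 x, mem_univ _⟩)
  · intro x _
    rcases le_total ‖x‖ (1 / 2) with hx | hx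
    · have : l x = 1 := by
        simp only [l]
        rw [min_eq_left (by linarith), max_eq_right zero_le_one]
      simp only [this]
      exact hψC _ (mem_image_of_mem _ (hy1 x))
    · refine hψW _ (hl01 x) _ ?_
      rw [hgγ _ (hy2 x hx)]
      exact hγW (hy2 x hx)
  · intro x hx
    have hx' : ‖x‖ = 1 := by simpa using hx
    have h1 : l x = 0 := by simp only [l, hx']; norm_num
    have h2 : y x = x := by simp only [y, hx']; norm_num
    simp only [h1, h2, hψ0, hgγ x hx]

/-- Stereographic projection from the point `p` of the sphere. -/
def stereo {n : ℕ} (p : Sph n) : OpenPartialHomeomorph (Sph n) (E n) :=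
  haveI := Fact.mk (@finrank_euclideanSpace_fin ℝ _ (n + 1))
  stereographic' n p

lemma stereo_source {n : ℕ} (p : Sph n) : (stereo p).source = {p}ᶜ := by
  have := Fact.mk (@finrank_euclideanSpace_fin ℝ _ (n + 1))
  exact stereographic'_source p

lemma stereo_target {n : ℕ} (p : Sph n) : (stereo p).target = univ := by
  have := Fact.mk (@finrank_euclideanSpace_fin ℝ _ (n + 1))
  exact stereographic'_target p

lemma stereo_mem_atlas {n : ℕ} (p : Sph n) : stereo p ∈ atlas (E n) (Sph n) :=
  ⟨p, rfl⟩

lemma stereo_symm_stereo {n : ℕ} {p x : Sph n} (hx : x ≠ p) : (stereo p).symm (stereo p x) = x :=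
  (stereo p).left_inv (by rwa [stereo_source])

lemma stereo_stereo_symm {n : ℕ} (p : Sph n) (w : E n) : stereo p ((stereo p).symm w) = w :=
  (stereo p).right_inv (by simp [stereo_target])

lemma stereo_symm_ne {n : ℕ} (p : Sph n) (w : E n) : (stereo p).symm w ≠ p := by
  have := (stereo p).map_target (x := w) (by simp [stereo_target])
  rwa [stereo_source] at this

lemma continuous_stereo_symm {n : ℕ} (p : Sph n) : Continuous (stereo p).symm := by
  have := (stereo p).symm.continuousOn
  rwa [(stereo p).symm_source, stereo_target, continuousOn_univ] at this

lemma continuousOn_stereo {n : ℕ} (p : Sph n) : ContinuousOn (stereo p) {p}ᶜ := by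
  have := (stereo p).continuousOn
  rwa [stereo_source] at this

lemma inner_stereo_symm {n : ℕ} (p : Sph n) (w : E n) :
    inner ℝ ((stereo p).symm w : E (n + 1)) (p : E (n + 1)) = (‖w‖ ^ 2 - 4) / (‖w‖ ^ 2 + 4) := by
  have := Fact.mk (@finrank_euclideanSpace_fin ℝ _ (n + 1))
  have hp : ‖(p : E (n + 1))‖ = 1 := by simp
  have h := stereographic'_symm_apply (n := n) p w
  simp only at h
  set U := (OrthonormalBasis.fromOrthogonalSpanSingleton (𝕜 := ℝ) n
    (ne_zero_of_mem_unit_sphere p)).repr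
  have h0 : inner ℝ ((U.symm w : _) : E (n + 1)) (p : E (n + 1)) = 0 := by
    rw [real_inner_comm]
    exact Submodule.mem_orthogonal_singleton_iff_inner_right.1 (U.symm w).2
  have hn : ‖((U.symm w : _) : E (n + 1))‖ = ‖w‖ := by
    exact U.symm.norm_map w
  change inner ℝ (((stereographic' n p).symm w : _) : E (n + 1)) (p : E (n + 1)) = _
  rw [h, inner_add_left, inner_smul_left, inner_smul_left, inner_smul_left, hn]
  erw [inner_smul_left]
  rw [h0, real_inner_self_eq_norm_sq, hp]
  simp only [conj_trivial]
  ring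

lemma stereo_symm_zero {n : ℕ} (p : Sph n) : (stereo p).symm 0 = -p := by
  have h := inner_stereo_symm p 0
  have h1 : ‖((stereo p).symm 0 : E (n + 1))‖ = 1 := by simp
  have h2 : ‖((-p : Sph n) : E (n + 1))‖ = 1 := by simp
  refine Subtype.ext ((inner_eq_one_iff_of_norm_eq_one (𝕜 := ℝ) h1 h2).1 ?_)
  rw [coe_neg_sphere, inner_neg_right, h]
  norm_num

lemma norm_stereo_mul_norm_stereo_neg {n : ℕ} {p x : Sph n} (h : x ≠ p) (h' : x ≠ -p) :
    ‖stereo p x‖ * ‖stereo (-p) x‖ = 4 := by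
  have h1 := inner_stereo_symm p (stereo p x)
  have h2 := inner_stereo_symm (-p) (stereo (-p) x)
  rw [stereo_symm_stereo h] at h1
  rw [stereo_symm_stereo h', coe_neg_sphere, inner_neg_right, h1] at h2
  set a := ‖stereo p x‖
  set b := ‖stereo (-p) x‖
  have ha : 0 ≤ a := norm_nonneg _
  have hb : 0 ≤ b := norm_nonneg _
  rw [← neg_div, div_eq_div_iff (by positivity) (by positivity)] at h2
  nlinarith [mul_nonneg ha hb]

/-- The expression of a smooth embedding in stereographic charts. -/
lemma contDiffOn_stereo_comp {m n : ℕ} {f : Sph m → Sph n} (hf : IsSmoothEmbedding f)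
    (o : Sph m) (p : Sph n) :
    ContDiffOn ℝ (⊤ : ℕ∞) (fun y => stereo p (f ((stereo o).symm y)))
      {y | f ((stereo o).symm y) ≠ p} := by
  rw [← contMDiffOn_iff_contDiffOn]
  have h1 : ContMDiffOn (𝓡 n) (𝓡 n) (⊤ : ℕ∞) (stereo p) (stereo p).source :=
    contMDiffOn_of_mem_maximalAtlas (IsManifold.subset_maximalAtlas (stereo_mem_atlas p))
  have h2 : ContMDiffOn (𝓡 m) (𝓡 m) (⊤ : ℕ∞) (stereo o).symm (stereo o).target :=
    contMDiffOn_symm_of_mem_maximalAtlas (IsManifold.subset_maximalAtlas (stereo_mem_atlas o))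
  rw [stereo_target] at h2
  rw [stereo_source] at h1
  exact h1.comp ((hf.1.contMDiffOn (s := univ)).comp (h2.mono (subset_univ _))
    (fun _ _ => mem_univ _)) fun y hy => hy

lemma isOpen_setOf_stereo_symm_ne {m n : ℕ} {f : Sph m → Sph n} (hf : IsSmoothEmbedding f)
    (o : Sph m) (p : Sph n) : IsOpen {y | f ((stereo o).symm y) ≠ p} :=
  isOpen_compl_singleton.preimage (hf.2.1.continuous.comp (continuous_stereo_symm o))

lemma injective_fderiv_stereo_comp {m n : ℕ} {f : Sph m → Sph n} (hf : IsSmoothEmbedding f)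
    (o : Sph m) (p : Sph n) {y : E m} (hy : f ((stereo o).symm y) ≠ p) :
    Function.Injective (fderiv ℝ (fun y => stereo p (f ((stereo o).symm y))) y) := by
  have h1 : (stereo p).MDifferentiable (𝓡 n) (𝓡 n) := mdifferentiable_of_mem_atlas (stereo_mem_atlas p)
  have h2 : (stereo o).MDifferentiable (𝓡 m) (𝓡 m) := mdifferentiable_of_mem_atlas (stereo_mem_atlas o)
  have hyt : y ∈ (stereo o).symm.source := by simp [stereo_target]
  have hys : f ((stereo o).symm y) ∈ (stereo p).source := by rwa [stereo_source]
  have d1 : MDifferentiableAt (𝓡 m) (𝓡 m) (stereo o).symm y := h2.symm.mdifferentiableAt hyt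
  have d2 : MDifferentiableAt (𝓡 m) (𝓡 n) f ((stereo o).symm y) :=
    (hf.1 _).mdifferentiableAt (by simp)
  have d3 : MDifferentiableAt (𝓡 n) (𝓡 n) (stereo p) (f ((stereo o).symm y)) :=
    h1.mdifferentiableAt hys
  rw [← mfderiv_eq_fderiv]
  have e1 := mfderiv_comp y d3 (d2.comp y d1)
  have e2 := mfderiv_comp y d2 d1
  change Function.Injective (mfderiv (𝓡 m) (𝓡 n) (stereo p ∘ f ∘ (stereo o).symm) y)
  rw [e1, e2]
  exact (h1.mfderiv_injective hys).comp ((hf.2.2 _).comp (h2.symm.mfderiv_injective hyt))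

lemma exists_prod_equiv_extending {G G' F : Type*} [NormedAddCommGroup G] [NormedSpace ℝ G]
    [FiniteDimensional ℝ G] [NormedAddCommGroup G'] [NormedSpace ℝ G'] [FiniteDimensional ℝ G']
    [NormedAddCommGroup F] [NormedSpace ℝ F] [FiniteDimensional ℝ F] (D : G →L[ℝ] F)
    (hD : Function.Injective D)
    (h : Module.finrank ℝ G + Module.finrank ℝ G' = Module.finrank ℝ F) :
    ∃ e : (G × G') ≃L[ℝ] F, ∀ u, e (u, 0) = D u := by
  obtain ⟨C, hC⟩ := Submodule.exists_isCompl (LinearMap.range (D : G →ₗ[ℝ] F))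
  have h1 := Submodule.finrank_add_eq_of_isCompl hC
  have h2 : Module.finrank ℝ (LinearMap.range (D : G →ₗ[ℝ] F)) = Module.finrank ℝ G :=
    LinearMap.finrank_range_of_inj hD
  let b : G' ≃ₗ[ℝ] C := LinearEquiv.ofFinrankEq _ _ (by omega)
  let e := ((LinearEquiv.ofInjective (D : G →ₗ[ℝ] F) hD).prodCongr b).trans
    (Submodule.prodEquivOfIsCompl _ _ hC)
  refine ⟨e.toContinuousLinearEquiv, fun u => ?_⟩
  simp [e]

/-- A slice chart of an embedded sphere at the image of a given point. -/
lemma exists_slice_chart {f : Sph 3 → Sph 6} (hf : IsSmoothEmbedding f) (o : Sph 3) :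
    ∃ (Θ : OpenPartialHomeomorph (E 3 × E 3) (Sph 6)) (r : ℝ), 0 < r ∧ ball 0 r ⊆ Θ.source ∧
      (∀ u ∈ ball (0 : E 3) r, Θ (u, 0) = f ((stereo (-o)).symm u)) ∧
      ∀ q ∈ ball (0 : E 3 × E 3) r, Θ q ∈ range f → q.2 = 0 := by
  set σ := (stereo (-o)).symm with hσ
  set p : Sph 6 := -f o with hp
  have hσ0 : σ 0 = o := by rw [hσ, stereo_symm_zero, neg_neg]
  have h0 : f (σ 0) ≠ p := by rw [hσ0, hp]; exact ne_neg_of_mem_unit_sphere ℝ _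
  set V := {y | f (σ y) ≠ p} with hV
  have hVo : IsOpen V := isOpen_setOf_stereo_symm_ne hf (-o) p
  set g : E 3 → E 6 := fun y => stereo p (f (σ y)) with hg
  have hgd : ContDiffAt ℝ (⊤ : ℕ∞) g 0 :=
    (contDiffOn_stereo_comp hf (-o) p).contDiffAt (hVo.mem_nhds h0)
  obtain ⟨e, he⟩ := exists_prod_equiv_extending (G' := E 3) (fderiv ℝ g 0)
    (injective_fderiv_stereo_comp hf (-o) p h0) (by simp)
  have hstrict : HasStrictFDerivAt (fun q : E 3 × E 3 => g q.1 + e (0, q.2))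
      (e : (E 3 × E 3) →L[ℝ] E 6) 0 := by
    have h1 : HasStrictFDerivAt (fun q : E 3 × E 3 => g q.1)
        ((fderiv ℝ g 0).comp (ContinuousLinearMap.fst ℝ (E 3) (E 3))) 0 :=
      (hgd.hasStrictFDerivAt (by simp)).comp (0 : E 3 × E 3) hasStrictFDerivAt_fst
    have h2 : HasStrictFDerivAt (fun q : E 3 × E 3 => e (0, q.2))
        ((e : (E 3 × E 3) →L[ℝ] E 6).comp ((ContinuousLinearMap.inr ℝ (E 3) (E 3)).comp
          (ContinuousLinearMap.snd ℝ (E 3) (E 3)))) 0 :=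
      ((e : (E 3 × E 3) →L[ℝ] E 6).comp ((ContinuousLinearMap.inr ℝ (E 3) (E 3)).comp
        (ContinuousLinearMap.snd ℝ (E 3) (E 3)))).hasStrictFDerivAt
    refine (h1.add h2).congr_fderiv (ContinuousLinearMap.ext fun q => Eq.symm ?_)
    change e q = fderiv ℝ g 0 q.1 + e (0, q.2)
    rw [← he, ← map_add]
    simp
  set h := hstrict.toOpenPartialHomeomorph _ with hh
  have hh0 : (0 : E 3 × E 3) ∈ h.source := hstrict.mem_toOpenPartialHomeomorph_source
  set Θ := h.trans (stereo p).symm with hΘ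
  have hΘs : Θ.source = h.source := by
    simp [hΘ, stereo_target]
  have hΘapp : ∀ q, Θ q = (stereo p).symm (g q.1 + e (0, q.2)) := fun q => rfl
  have hΘ0 : ∀ u ∈ V, Θ (u, 0) = f (σ u) := by
    intro u hu
    rw [hΘapp]
    have : e ((0 : E 3), (0 : E 3)) = 0 := map_zero e
    simp only [this, add_zero, hg]
    exact stereo_symm_stereo hu
  have hn1 : Θ.source ∩ Prod.fst ⁻¹' V ∈ 𝓝 (0 : E 3 × E 3) :=
    ((Θ.open_source.inter (hVo.preimage continuous_fst)).mem_nhds ⟨by rwa [hΘs], h0⟩)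
  obtain ⟨r₁, hr₁, hb₁⟩ := Metric.mem_nhds_iff.1 hn1
  have hop : IsOpen (σ '' ball 0 r₁) :=
    σ.isOpen_image_of_subset_source isOpen_ball (by simp [hσ, stereo_target])
  have hK : IsCompact (f '' (σ '' ball 0 r₁)ᶜ) :=
    (hop.isClosed_compl.isCompact).image hf.2.1.continuous
  have hn2 : ∀ᶠ q in 𝓝 (0 : E 3 × E 3), Θ q ∉ f '' (σ '' ball 0 r₁)ᶜ := by
    refine (Θ.continuousAt (by rwa [hΘs])).eventually_mem (hK.isClosed.isOpen_compl.mem_nhds ?_)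
    rintro ⟨x, hx, hxe⟩
    have h1 : Θ (0 : E 3 × E 3) = f (σ 0) := hΘ0 0 h0
    rw [h1] at hxe
    exact hx ⟨0, mem_ball_self hr₁, (hf.2.1.injective hxe).symm⟩
  obtain ⟨r₂, hr₂, hb₂⟩ := Metric.mem_nhds_iff.1 hn2
  have hfst : ∀ u ∈ ball (0 : E 3) r₁, ((u, 0) : E 3 × E 3) ∈ ball (0 : E 3 × E 3) r₁ := by
    intro u hu
    rw [mem_ball_zero_iff] at hu ⊢
    rw [Prod.norm_def, max_lt_iff]
    exact ⟨hu, by simpa using hr₁⟩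
  refine ⟨Θ, min r₁ r₂, lt_min hr₁ hr₂, ?_, ?_, ?_⟩
  · exact fun q hq => (hb₁ (ball_subset_ball (min_le_left _ _) hq)).1
  · exact fun u hu => hΘ0 u (hb₁ (hfst u (ball_subset_ball (min_le_left _ _) hu))).2
  · rintro q hq ⟨x, hx⟩
    have hq1 := hb₁ (ball_subset_ball (min_le_left _ _) hq)
    have hq2 := hb₂ (ball_subset_ball (min_le_right _ _) hq)
    by_cases hxb : x ∈ σ '' ball 0 r₁
    · obtain ⟨u, hu, rfl⟩ := hxb
      have hu1 := hb₁ (hfst u hu)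
      rw [← hΘ0 u hu1.2] at hx
      rw [← Θ.injOn hu1.1 hq1.1 hx]
    · exact absurd ⟨x, hxb, hx⟩ hq2

/-- A punctured slice chart is homotopy equivalent to the normal sphere. -/
lemma nonempty_homotopyEquiv_punctured {M : Type*} [TopologicalSpace M]
    (Θ : OpenPartialHomeomorph (E 3 × E 3) M) {r : ℝ} (hr : 0 < r) (hs : ball 0 r ⊆ Θ.source) :
    Nonempty (ContinuousMap.HomotopyEquiv (Θ '' {q | q ∈ ball 0 r ∧ q.2 ≠ 0} : Set M) (Sph 2)) := by
  set A : Set M := Θ '' {q | q ∈ ball 0 r ∧ q.2 ≠ 0} with hA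
  have hsymm : ∀ z ∈ A, Θ.symm z ∈ ball 0 r ∧ (Θ.symm z).2 ≠ 0 ∧ Θ (Θ.symm z) = z := by
    rintro _ ⟨q, ⟨hq, hq2⟩, rfl⟩
    rw [Θ.left_inv (hs hq)]
    exact ⟨hq, hq2, rfl⟩
  have hAt : A ⊆ Θ.target := by
    rintro _ ⟨q, ⟨hq, hq2⟩, rfl⟩
    exact Θ.map_source (hs hq)
  have hcs : ContinuousOn Θ.symm A := Θ.continuousOn_symm.mono hAt
  have hcn : ContinuousOn (fun z => ‖(Θ.symm z).2‖⁻¹ • (Θ.symm z).2) A := by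
    have h2 : ContinuousOn (fun z => (Θ.symm z).2) A := continuous_snd.comp_continuousOn hcs
    exact (h2.norm.inv₀ fun z hz => norm_ne_zero_iff.2 (hsymm z hz).2.1).smul h2
  have hball : ∀ q : E 3 × E 3, q ∈ ball (0 : E 3 × E 3) r ↔ ‖q.1‖ < r ∧ ‖q.2‖ < r := by
    intro q
    rw [mem_ball_zero_iff, Prod.norm_def, max_lt_iff]
  have hun : ∀ z : A, ‖(Θ.symm z).2‖⁻¹ • (Θ.symm z).2 ∈ sphere (0 : E 3) 1 := fun z => by
    rw [mem_sphere_zero_iff_norm, norm_smul, norm_inv, norm_norm,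
      inv_mul_cancel₀ (norm_ne_zero_iff.2 (hsymm z z.2).2.1)]
  let F : C(A, Sph 2) := ⟨fun z => ⟨‖(Θ.symm z).2‖⁻¹ • (Θ.symm z).2, hun z⟩,
    (continuousOn_iff_continuous_domRestrict.1 hcn).subtype_mk hun⟩
  have hq : ∀ v : Sph 2, ((0, (r / 2) • (v : E 3)) : E 3 × E 3) ∈ ball (0 : E 3 × E 3) r ∧
      (r / 2) • (v : E 3) ≠ 0 := by
    intro v
    have hv : ‖(v : E 3)‖ = 1 := by simp
    have h1 : ‖(r / 2) • (v : E 3)‖ = r / 2 := by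
      rw [norm_smul, hv, mul_one, Real.norm_of_nonneg (by positivity)]
    refine ⟨(hball _).2 ⟨by simpa using hr, by simp only [h1]; linarith⟩, ?_⟩
    rw [← norm_ne_zero_iff, h1]
    positivity
  let G : C(Sph 2, A) := ⟨fun v => ⟨Θ (0, (r / 2) • (v : E 3)), mem_image_of_mem _ (hq v)⟩,
    (Θ.continuousOn.comp_continuous (f := fun v : Sph 2 => ((0 : E 3), (r / 2) • (v : E 3)))
      (by fun_prop) fun v => hs (hq v).1).subtype_mk _⟩
  refine ⟨⟨F, G, ?_, ?_⟩⟩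
  · let H : M → ℝ → M := fun z s => Θ (s • (Θ.symm z).1,
      ((1 - s) * (r / 2) * ‖(Θ.symm z).2‖⁻¹ + s) • (Θ.symm z).2)
    have hmem : ∀ z ∈ A, ∀ s ∈ Icc (0 : ℝ) 1, ((s • (Θ.symm z).1,
        ((1 - s) * (r / 2) * ‖(Θ.symm z).2‖⁻¹ + s) • (Θ.symm z).2) : E 3 × E 3) ∈
        {q : E 3 × E 3 | q ∈ ball (0 : E 3 × E 3) r ∧ q.2 ≠ 0} := by
      intro z hz s hs'
      obtain ⟨hz1, hz2, -⟩ := hsymm z hz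
      rw [hball] at hz1
      have hpos : 0 < ‖(Θ.symm z).2‖ := norm_pos_iff.2 hz2
      have hc : 0 < (1 - s) * (r / 2) * ‖(Θ.symm z).2‖⁻¹ + s := by
        rcases eq_or_lt_of_le hs'.1 with h | h
        · rw [← h]; simp only [sub_zero, one_mul, add_zero]; positivity
        · have : 0 ≤ 1 - s := by linarith [hs'.2]
          positivity
      refine ⟨(hball _).2 ⟨?_, ?_⟩, smul_ne_zero hc.ne' hz2⟩
      · simp only [norm_smul, Real.norm_of_nonneg hs'.1]
        exact (mul_le_of_le_one_left (norm_nonneg _) hs'.2).trans_lt hz1.1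
      · simp only [norm_smul, Real.norm_of_nonneg hc.le]
        rw [add_mul, mul_assoc _ _ ‖(Θ.symm z).2‖, inv_mul_cancel₀ hpos.ne', mul_one]
        have h3 : ‖(Θ.symm z).2‖ < r := hz1.2
        rcases eq_or_lt_of_le hs'.1 with h | h
        · rw [← h]; linarith
        · nlinarith [hs'.2]
    refine homotopic_of_continuousOn H ?_ (fun z hz s hs' => mem_image_of_mem _ (hmem z hz s hs'))
      ?_ ?_
    · refine Θ.continuousOn.comp (f := fun w : M × ℝ => ((w.2 • (Θ.symm w.1).1,
        ((1 - w.2) * (r / 2) * ‖(Θ.symm w.1).2‖⁻¹ + w.2) • (Θ.symm w.1).2) : E 3 × E 3)) ?_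
        fun w hw => hs (hmem w.1 hw.1 w.2 hw.2).1
      have h1 : ContinuousOn (fun w : M × ℝ => Θ.symm w.1) (A ×ˢ Icc (0 : ℝ) 1) :=
        hcs.comp continuousOn_fst fun w hw => hw.1
      have h2 : ContinuousOn (fun w : M × ℝ => (Θ.symm w.1).2) (A ×ˢ Icc (0 : ℝ) 1) :=
        continuous_snd.comp_continuousOn h1
      have h3 : ContinuousOn (fun w : M × ℝ => (Θ.symm w.1).1) (A ×ˢ Icc (0 : ℝ) 1) :=
        continuous_fst.comp_continuousOn h1
      have h4 := h2.norm.inv₀ fun w hw => norm_ne_zero_iff.2 (hsymm w.1 hw.1).2.1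
      have h5 : ContinuousOn (fun w : M × ℝ => (1 - w.2) * (r / 2) * ‖(Θ.symm w.1).2‖⁻¹ + w.2)
          (A ×ˢ Icc (0 : ℝ) 1) :=
        (((continuousOn_const.sub continuousOn_snd).mul continuousOn_const).mul h4).add
          continuousOn_snd
      have h6 : ContinuousOn (fun w : M × ℝ => w.2 • (Θ.symm w.1).1) (A ×ˢ Icc (0 : ℝ) 1) :=
        continuousOn_snd.smul h3
      exact h6.prodMk (h5.smul h2)
    · intro z
      change Θ _ = Θ (0, (r / 2) • (‖(Θ.symm z).2‖⁻¹ • (Θ.symm z).2))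
      simp [smul_smul]
    · intro z
      change Θ _ = (z : M)
      simp [(hsymm z z.2).2.2]
  · convert ContinuousMap.Homotopic.refl _
    ext1 v
    refine Subtype.ext ?_
    change (v : E 3) = ‖(Θ.symm (Θ (0, (r / 2) • (v : E 3)))).2‖⁻¹ •
      (Θ.symm (Θ (0, (r / 2) • (v : E 3)))).2
    rw [Θ.left_inv (hs (hq v).1)]
    have hv : ‖(v : E 3)‖ = 1 := by simp
    simp only [norm_smul, hv, mul_one, smul_smul]
    rw [Real.norm_of_nonneg (by positivity), inv_mul_cancel₀ (by positivity), one_smul]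

lemma compl_image_stereo_symm_ball {n : ℕ} (o : Sph n) {r : ℝ} (hr : 0 < r) :
    ((stereo (-o)).symm '' ball 0 r)ᶜ = (stereo o).symm '' closedBall 0 (4 / r) := by
  ext x
  constructor
  · intro hx
    have hxo : x ≠ o := by
      rintro rfl
      exact hx ⟨0, mem_ball_self hr, by rw [stereo_symm_zero, neg_neg]⟩
    refine ⟨stereo o x, ?_, stereo_symm_stereo hxo⟩
    rw [mem_closedBall_zero_iff, le_div_iff₀ hr]
    by_cases hxo' : x = -o
    · rw [hxo', ← stereo_symm_zero o, stereo_stereo_symm, norm_zero, zero_mul]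
      norm_num
    · have h : r ≤ ‖stereo (-o) x‖ := by
        by_contra! h
        exact hx ⟨_, mem_ball_zero_iff.2 h, stereo_symm_stereo hxo'⟩
      rw [← norm_stereo_mul_norm_stereo_neg hxo hxo']
      gcongr
  · rintro ⟨y, hy, rfl⟩ ⟨u, hu, hxu⟩
    have h := norm_stereo_mul_norm_stereo_neg (stereo_symm_ne o y)
      (hxu ▸ stereo_symm_ne (-o) u)
    rw [stereo_stereo_symm, ← hxu, stereo_stereo_symm] at h
    rw [mem_closedBall_zero_iff, le_div_iff₀ hr] at hy
    rw [mem_ball_zero_iff] at hu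
    rcases (norm_nonneg y).eq_or_lt with h0 | h0
    · rw [← h0, zero_mul] at h
      norm_num at h
    · nlinarith

lemma sphereExt_compl_singleton {n : ℕ} (p : Sph n) (k : ℕ) : SphereExt k ({p}ᶜ : Set (Sph n)) :=
  (sphereExt_of_convex (convex_univ (E := E n)) univ_nonempty k).of_retract
    (continuousOn_stereo p) (continuous_stereo_symm p).continuousOn (mapsTo_univ _ _)
    (fun w _ => stereo_symm_ne p w) fun _ hx => stereo_symm_stereo hx

/-- A compactly supported deformation of the stereographic chart extends to the sphere. -/
lemma exists_deformation_extension {n : ℕ} (p : Sph n) {ψ : ℝ → E n → E n} {T B : ℝ} (hT : 0 ≤ T)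
    (hψ : ContinuousOn (Function.uncurry ψ) (Icc 0 T ×ˢ univ))
    (hB : ∀ s ∈ Icc 0 T, ∀ z, B ≤ ‖z‖ → ψ s z = z) :
    ∃ Ψ : ℝ → Sph n → Sph n, ContinuousOn (Function.uncurry Ψ) (Icc 0 1 ×ˢ univ) ∧
      (∀ s, Ψ s p = p) ∧ ∀ s, ∀ z ≠ p, Ψ s z = (stereo p).symm (ψ (s * T) (stereo p z)) := by
  classical
  let Ψ : ℝ → Sph n → Sph n := fun s z =>
    if z = p then p else (stereo p).symm (ψ (s * T) (stereo p z))
  have hΨ : ∀ s, ∀ z ≠ p, Ψ s z = (stereo p).symm (ψ (s * T) (stereo p z)) :=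
    fun s z hz => if_neg hz
  have hsT : ∀ s ∈ Icc (0 : ℝ) 1, s * T ∈ Icc 0 T := fun s hs =>
    ⟨mul_nonneg hs.1 hT, mul_le_of_le_one_left hT hs.2⟩
  refine ⟨Ψ, ?_, fun s => if_pos rfl, hΨ⟩
  rintro ⟨s, z⟩ ⟨hs, -⟩
  by_cases hz : z = p
  · have hK : IsClosed ((stereo p).symm '' closedBall 0 B) :=
      ((isCompact_closedBall _ _).image (continuous_stereo_symm p)).isClosed
    have hpK : p ∉ (stereo p).symm '' closedBall 0 B := fun ⟨w, _, hw⟩ => stereo_symm_ne p w hw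
    refine (continuousWithinAt_snd (s := Icc (0 : ℝ) 1 ×ˢ (univ : Set (Sph n)))
      (p := (s, z))).congr_of_eventuallyEq ?_ ?_
    · have hn : ∀ᶠ w : ℝ × Sph n in 𝓝[Icc (0 : ℝ) 1 ×ˢ univ] (s, z),
          w.2 ∉ (stereo p).symm '' closedBall 0 B :=
        continuousWithinAt_snd.eventually_mem
          (hK.isOpen_compl.mem_nhds (show z ∈ ((stereo p).symm '' closedBall 0 B)ᶜ by rwa [hz]))
      filter_upwards [hn, self_mem_nhdsWithin] with w hw hw'
      change Ψ w.1 w.2 = w.2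
      by_cases hwp : w.2 = p
      · rw [hwp]
        exact if_pos rfl
      · rw [hΨ _ _ hwp, hB _ (hsT _ hw'.1), stereo_symm_stereo hwp]
        by_contra! h
        exact hw ⟨_, mem_closedBall_zero_iff.2 h.le, stereo_symm_stereo hwp⟩
    · exact (if_pos hz).trans hz.symm
  · have hc : ContinuousOn (fun w : ℝ × Sph n => (stereo p).symm (ψ (w.1 * T) (stereo p w.2)))
        (Icc (0 : ℝ) 1 ×ˢ {p}ᶜ) := by
      refine (continuous_stereo_symm p).comp_continuousOn (hψ.comp
        (f := fun w : ℝ × Sph n => (w.1 * T, stereo p w.2))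
        ((continuousOn_fst.mul continuousOn_const).prodMk
          ((continuousOn_stereo p).comp continuousOn_snd fun w hw => hw.2))
        fun w hw => ⟨hsT _ hw.1, mem_univ _⟩)
    have hc' : ContinuousOn (Function.uncurry Ψ) (Icc (0 : ℝ) 1 ×ˢ {p}ᶜ) :=
      hc.congr fun w hw => hΨ _ _ hw.2
    refine (hc' (s, z) ⟨hs, hz⟩).mono_of_mem_nhdsWithin ?_
    have hn : (univ : Set ℝ) ×ˢ ({p}ᶜ : Set (Sph n)) ∈ 𝓝 (s, z) :=
      (isOpen_univ.prod isOpen_compl_singleton).mem_nhds ⟨mem_univ _, hz⟩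
    filter_upwards [mem_nhdsWithin_of_mem_nhds hn, self_mem_nhdsWithin] with w hw hw'
    exact ⟨hw'.1, hw.2⟩

lemma IsSmoothEmbedding.stereo_comp_ne {m n : ℕ} {f : Sph m → Sph n} (hf : IsSmoothEmbedding f)
    (o : Sph m) (y : E m) : f ((stereo o).symm y) ≠ f o :=
  fun h => stereo_symm_ne o y (hf.2.1.injective h)

lemma IsSmoothEmbedding.contDiff_stereo_comp {m n : ℕ} {f : Sph m → Sph n}
    (hf : IsSmoothEmbedding f) (o : Sph m) :
    ContDiff ℝ (⊤ : ℕ∞) fun y => stereo (f o) (f ((stereo o).symm y)) :=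
  contDiffOn_univ.1 ((contDiffOn_stereo_comp hf o (f o)).mono fun y _ => hf.stereo_comp_ne o y)

/-- The complement of an embedded closed disk is weakly contractible. -/
lemma IsSmoothEmbedding.sphereExt_compl_image_closedBall {m n : ℕ} {f : Sph m → Sph n}
    (hf : IsSmoothEmbedding f) (o : Sph m) {R : ℝ} (hR : 0 ≤ R) (k : ℕ) :
    SphereExt k (f '' ((stereo o).symm '' closedBall 0 R))ᶜ := by
  set τ := (stereo o).symm with hτ
  refine sphereExt_of_flow (sphereExt_compl_singleton (f (τ 0)) k) ?_ ?_
  · refine compl_subset_compl.2 (singleton_subset_iff.2 ?_)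
    exact mem_image_of_mem _ (mem_image_of_mem _ (mem_closedBall_self hR))
  intro C hCP hC
  have hfτ : Continuous fun y => f (τ y) := hf.2.1.continuous.comp (continuous_stereo_symm o)
  have h0C : f (τ 0) ∉ C := fun h => hCP h rfl
  obtain ⟨ε, hε, hεC⟩ := Metric.mem_nhds_iff.1
    ((hC.isClosed.isOpen_compl.preimage hfτ).mem_nhds h0C)
  obtain ⟨T, hTR, hT⟩ : ∃ T : ℝ, Real.exp (-T) * R < ε ∧ 0 ≤ T := by
    have h := Real.tendsto_exp_neg_atTop_nhds_zero.mul_const R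
    rw [zero_mul] at h
    exact ((h.eventually_lt_const hε).and (Filter.eventually_ge_atTop 0)).exists
  have hne : ∀ y, f (τ y) ≠ f o := hf.stereo_comp_ne o
  have hGinj : Function.Injective fun y => stereo (f o) (f (τ y)) := by
    intro y y' h
    have h' := congrArg (stereo (f o)).symm h
    simp only [stereo_symm_stereo (hne _)] at h'
    have h2 := congrArg (stereo o) (hf.2.1.injective h')
    simpa only [hτ, stereo_stereo_symm] using h2
  obtain ⟨ψ, B, hψ, hψ0, hψB, hψR⟩ := exists_expanding_flow
    ((hf.contDiff_stereo_comp o).of_le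
      (WithTop.coe_le_coe.2 (le_top : (2 : ℕ∞) ≤ ⊤))) hGinj
    (fun y => injective_fderiv_stereo_comp hf o (f o) (hf.stereo_comp_ne o y)) R hT
  obtain ⟨Ψ, hΨ, hΨp, hΨf⟩ := exists_deformation_extension (f o) hT hψ hψB
  have hsT : ∀ s ∈ Icc (0 : ℝ) 1, s * T ∈ Icc 0 T := fun s hs =>
    ⟨mul_nonneg hs.1 hT, mul_le_of_le_one_left hT hs.2⟩
  have key : ∀ s ∈ Icc (0 : ℝ) 1, ∀ z, ∀ y ∈ closedBall (0 : E m) R, f (τ y) = Ψ s z →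
      z = f (τ (Real.exp (-(s * T)) • y)) := by
    intro s hs z y hy h
    by_cases hz : z = f o
    · rw [hz, hΨp] at h
      exact absurd h (hne y)
    · rw [hΨf s z hz] at h
      have h1 := hψR (s * T) (hsT s hs) (stereo (f o) z) y hy
        (by rw [h, stereo_stereo_symm])
      have h2 := congrArg (stereo (f o)).symm h1
      rwa [stereo_symm_stereo hz, stereo_symm_stereo (hne _)] at h2
  refine ⟨Ψ, hΨ, ?_, ?_, ?_⟩
  · intro z
    by_cases hz : z = f o
    · rw [hz, hΨp]
    · rw [hΨf 0 z hz, zero_mul, hψ0, stereo_symm_stereo hz]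
  · rintro s hs z hz ⟨_, ⟨y, hy, rfl⟩, h⟩
    refine hz ⟨_, ⟨Real.exp (-(s * T)) • y, ?_, rfl⟩, (key s hs z y hy h).symm⟩
    rw [mem_closedBall_zero_iff] at hy ⊢
    rw [norm_smul, Real.norm_of_nonneg (Real.exp_pos _).le]
    exact (mul_le_of_le_one_left (norm_nonneg _)
      (Real.exp_le_one_iff.2 (neg_nonpos.2 (hsT s hs).1))).trans hy
  · rintro z hz ⟨_, ⟨y, hy, rfl⟩, h⟩
    have h1 := key 1 (by simp) z y hy h
    rw [one_mul] at h1
    rw [h1] at hz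
    refine hεC (?_ : Real.exp (-T) • y ∈ ball 0 ε) hz
    rw [mem_closedBall_zero_iff] at hy
    rw [mem_ball_zero_iff, norm_smul, Real.norm_of_nonneg (Real.exp_pos _).le]
    exact (mul_le_mul_of_nonneg_left hy (Real.exp_pos _).le).trans_lt hTR

/-- The complement of a smoothly embedded `3`-sphere in the `6`-sphere is simply connected. -/
lemma IsSmoothEmbedding.sphereExt_compl_range {f : Sph 3 → Sph 6} (hf : IsSmoothEmbedding f)
    (o : Sph 3) (hX : IsOpen (range f)ᶜ) : SphereExt 2 (range f)ᶜ := by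
  set g := fun y => stereo (f o) (f ((stereo o).symm y)) with hg
  have hpre : univ \ range g = (stereo (f o)).symm ⁻¹' (range f)ᶜ := by
    ext w
    simp only [mem_sdiff, mem_univ, true_and, mem_preimage, mem_compl_iff, not_iff_not]
    constructor
    · rintro ⟨y, rfl⟩
      rw [hg, stereo_symm_stereo (hf.stereo_comp_ne o y)]
      exact mem_range_self _
    · rintro ⟨x, hx⟩
      have hxo : x ≠ o := by
        rintro rfl
        exact stereo_symm_ne _ _ hx.symm
      refine ⟨stereo o x, ?_⟩
      simp only [hg, stereo_symm_stereo hxo, hx, stereo_stereo_symm]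
  have ho : IsOpen (univ \ range g) := hpre ▸ hX.preimage (continuous_stereo_symm _)
  have hsub : (range f)ᶜ ⊆ {f o}ᶜ :=
    compl_subset_compl.2 (singleton_subset_iff.2 (mem_range_self o))
  have h := sphereExt_diff_range convex_univ isOpen_univ univ_nonempty
    ((hf.contDiff_stereo_comp o).of_le (by exact_mod_cast le_top)) ho (k := 2) (by simp)
  rw [← hg, hpre] at h
  refine h.of_retract ((continuousOn_stereo (f o)).mono hsub)
    (continuous_stereo_symm _).continuousOn ?_ (fun w hw => hw)
    fun x hx => stereo_symm_stereo (hsub hx)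
  intro x hx
  rwa [mem_preimage, stereo_symm_stereo (hsub hx)]

theorem statement6 (f : Sph 3 → Sph 6) (hf : IsSmoothEmbedding f) :
    Nonempty (ContinuousMap.HomotopyEquiv ((Set.range f)ᶜ : Set (Sph 6)) (Sph 2)) := by
  obtain ⟨o⟩ : Nonempty (Sph 3) := (NormedSpace.sphere_nonempty.2 zero_le_one).to_subtype
  obtain ⟨Θ, r, hr, hs, hΘ, hΘf⟩ := exists_slice_chart hf o
  have hX : IsOpen (range f)ᶜ := (isCompact_range hf.2.1.continuous).isClosed.isOpen_compl
  set N := Θ '' ball 0 r with hN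
  have hNo : IsOpen N := Θ.isOpen_image_of_subset_source isOpen_ball hs
  have hfst : ∀ q ∈ ball (0 : E 3 × E 3) r, q.1 ∈ ball (0 : E 3) r := by
    intro q hq
    rw [mem_ball_zero_iff] at hq ⊢
    exact (norm_fst_le q).trans_lt hq
  have hA : Θ '' {q | q ∈ ball 0 r ∧ q.2 ≠ 0} = (range f)ᶜ ∩ N := by
    ext z
    constructor
    · rintro ⟨q, ⟨hq, hq2⟩, rfl⟩
      exact ⟨fun h => hq2 (hΘf q hq h), mem_image_of_mem _ hq⟩
    · rintro ⟨hz, q, hq, rfl⟩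
      refine ⟨q, ⟨hq, fun h => hz ?_⟩, rfl⟩
      rw [show q = (q.1, 0) from Prod.ext rfl h, hΘ _ (hfst q hq)]
      exact mem_range_self _
  have hW : (range f)ᶜ ∪ N = (f '' ((stereo o).symm '' closedBall 0 (4 / r)))ᶜ := by
    rw [← compl_image_stereo_symm_ball o hr]
    ext z
    rw [← not_iff_not, mem_compl_iff, not_not, mem_union, not_or, mem_compl_iff, not_not]
    constructor
    · rintro ⟨⟨x, rfl⟩, hx⟩
      refine ⟨x, fun ⟨u, hu, hux⟩ => hx ⟨(u, 0), ?_, by rw [hΘ u hu, hux]⟩, rfl⟩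
      rw [mem_ball_zero_iff] at hu ⊢
      rw [Prod.norm_def, max_lt_iff]
      exact ⟨hu, by simpa using hr⟩
    · rintro ⟨x, hx, rfl⟩
      refine ⟨mem_range_self x, fun ⟨q, hq, hqx⟩ => hx ⟨q.1, hfst q hq, hf.2.1.injective ?_⟩⟩
      have h := hΘf q hq (hqx ▸ mem_range_self x)
      rw [← hΘ _ (hfst q hq), ← hqx, show (q.1, (0 : E 3)) = q from Prod.ext rfl h.symm]
  have hsymm : ∀ q ∈ ball (0 : E 3 × E 3) r, Θ.symm (Θ q) = q := fun q hq => Θ.left_inv (hs hq)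
  have hNt : N ⊆ Θ.target := by
    rintro _ ⟨q, hq, rfl⟩
    exact Θ.map_source (hs hq)
  have hNS : ∀ k, SphereExt k N := fun k =>
    (sphereExt_of_convex (convex_ball (0 : E 3 × E 3) r) ⟨0, mem_ball_self hr⟩ k).of_retract
      (Θ.continuousOn_symm.mono hNt) (Θ.continuousOn.mono hs)
      (by rintro _ ⟨q, hq, rfl⟩; rwa [hsymm q hq]) (mapsTo_image _ _)
      fun x hx => Θ.right_inv (hNt hx)
  have hAS : SphereExt 2 ((range f)ᶜ ∩ N) := by
    have hset : ball (0 : E 3 × E 3) r \ range (fun u : E 3 => (u, (0 : E 3))) =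
        {q | q ∈ ball 0 r ∧ q.2 ≠ 0} := by
      ext q
      refine and_congr_right fun _ => not_congr ⟨?_, fun h => ⟨q.1, Prod.ext rfl h.symm⟩⟩
      rintro ⟨u, rfl⟩
      rfl
    have ho : IsOpen (ball (0 : E 3 × E 3) r \ range (fun u : E 3 => (u, (0 : E 3)))) :=
      hset ▸ isOpen_ball.inter (isOpen_ne.preimage continuous_snd)
    have h := sphereExt_diff_range (convex_ball _ _) isOpen_ball ⟨0, mem_ball_self hr⟩
      (g := fun u : E 3 => (u, (0 : E 3))) (contDiff_id.prodMk contDiff_const) ho (k := 2) (by simp)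
    rw [← hA]
    rw [hset] at h
    refine h.of_retract (p := Θ.symm) (q := Θ)
      (Θ.continuousOn_symm.mono (hA.trans_subset (inter_subset_right.trans hNt)))
      (Θ.continuousOn.mono fun q hq => hs hq.1)
      (by rintro _ ⟨q, hq, rfl⟩; rwa [hsymm q hq.1]) (mapsTo_image _ _)
      fun x hx => Θ.right_inv (hNt (hA.trans_subset inter_subset_right hx))
  have hXS := hf.sphereExt_compl_range o hX
  have hcomp : ∀ k, Compressible k (range f)ᶜ ((range f)ᶜ ∩ N) := by
    refine Compressible.of_excision hX hNo
      (compressible_of_sphereExt inter_subset_left hXS (hAS.mono one_le_two)) ?_ fun k => ?_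
    · rw [inter_comm]
      exact compressible_of_sphereExt inter_subset_right (hNS 3) hAS
    · refine compressible_of_sphereExt subset_union_right ?_ (hNS k)
      rw [hW]
      exact hf.sphereExt_compl_image_closedBall o (by positivity) _
  have hsub : (range f)ᶜ ⊆ {f o}ᶜ :=
    compl_subset_compl.2 (singleton_subset_iff.2 (mem_range_self o))
  let L := EuclideanSpace.equiv (Fin 6) ℝ
  have hq : Continuous fun v => (stereo (f o)).symm (L.symm v) :=
    (continuous_stereo_symm _).comp L.symm.continuous
  have hqp : ∀ x ∈ (range f)ᶜ, (stereo (f o)).symm (L.symm (L (stereo (f o) x))) = x := by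
    intro x hx
    rw [L.symm_apply_apply, stereo_symm_stereo (hsub hx)]
  obtain ⟨e₁⟩ := nonempty_homotopyEquiv_of_compressible hcomp inter_subset_left (hX.inter hNo)
    (hX.preimage hq) (p := fun x => L (stereo (f o) x))
    (L.continuous.comp_continuousOn ((continuousOn_stereo (f o)).mono hsub)) hq.continuousOn
    (fun x hx => by rwa [mem_preimage, hqp x hx]) (fun v hv => hv) hqp
  obtain ⟨e₂⟩ := nonempty_homotopyEquiv_punctured Θ hr hs
  rw [hA] at e₂
  exact ⟨e₁.trans e₂⟩
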